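/- If a sequence of ARW(K_n,λ_n,ν_n) chains exhibits total-variation cutoff, then it also exhibits separation cutoff. -/

import Mathlib

open scoped ENNReal BigOperators
open Filter Asymptotics

namespace ARW

variable {V : Type} [Fintype V] [DecidableEq V]

/-- A sub-stochastic matrix: every row sums to at most `1`. -/
def SubStochastic (K : V → V → ℝ≥0∞) : Prop := ∀ x, ∑ y, K x y ≤ 1

/-- Non-degenerate: no principal sub-matrix of `K` is stochastic. -/
def NonDegenerate (K : V → V → ℝ≥0∞) : Prop :=
  ∀ S : Finset V, S.Nonempty → ∃ x ∈ S, ∑ y ∈ S, K x y ≠ 1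

/-- A probability vector on `V`. -/
def IsProbVec (ν : V → ℝ≥0∞) : Prop := ∑ x, ν x = 1

/-- Probability that the `K`-walk currently at `x` next follows the trajectory `xs`
and is then killed. -/
noncomputable def pathProb (K : V → V → ℝ≥0∞) : V → List V → ℝ≥0∞
  | x, [] => 1 - ∑ y, K x y
  | x, y :: ys => K x y * pathProb K y ys

/-- Probability that a `(K,ν)`-walk has the (finite) full trajectory `w`. -/
noncomputable def walkProb (K : V → V → ℝ≥0∞) (ν : V → ℝ≥0∞) : List V → ℝ≥0∞
  | [] => 0
  | x :: xs => ν x * pathProb K x xs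

/-- `p(x)`: the probability that a `(K,ν)`-walk visits `x` before dying. -/
noncomputable def hitProb (K : V → V → ℝ≥0∞) (ν : V → ℝ≥0∞) (x : V) : ℝ≥0∞ :=
  ∑' w : List V, if x ∈ w then walkProb K ν w else 0

/-- The insertion law `ν` is admissible when every site has a chance of being
visited by a `(K,ν)`-walk. -/
def Admissible (K : V → V → ℝ≥0∞) (ν : V → ℝ≥0∞) : Prop := ∀ x, 0 < hitProb K ν x

/-- The uniform law on `V`. -/
noncomputable def unifLaw (V : Type) [Fintype V] : V → ℝ≥0∞ :=
  fun _ => (Fintype.card V : ℝ≥0∞)⁻¹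

/-! ### IDLA -/

/-- The IDLA update: the walker settles at the first site of its trajectory
which is not already occupied. -/
def idlaUpdate (S : Finset V) : List V → Finset V
  | [] => S
  | x :: xs => if x ∈ S then idlaUpdate S xs else insert x S

/-- The IDLA aggregate obtained from the initial set `A` after using the walks `ws`. -/
def idlaSet (A : Finset V) (ws : List (List V)) : Finset V := ws.foldl idlaUpdate A

/-- `P(T^A > t)`: probability that the IDLA process started from `A` and driven by
i.i.d. `(K,ν)`-walks has not filled `V` after `t` steps. -/
noncomputable def idlaTail (K : V → V → ℝ≥0∞) (ν : V → ℝ≥0∞) (A : Finset V) (t : ℕ) : ℝ≥0∞ :=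
  ∑' ws : Fin t → List V,
    (∏ i, walkProb K ν (ws i)) * (if idlaSet A (List.ofFn ws) = Finset.univ then 0 else 1)

/-- `E[T^A]`: the expected filling time of IDLA started from `A`. -/
noncomputable def idlaMean (K : V → V → ℝ≥0∞) (ν : V → ℝ≥0∞) (A : Finset V) : ℝ≥0∞ :=
  ∑' t : ℕ, idlaTail K ν A t

/-- `Var(T^A)`: the variance of the filling time of IDLA started from `A`. -/
noncomputable def idlaVar (K : V → V → ℝ≥0∞) (ν : V → ℝ≥0∞) (A : Finset V) : ℝ≥0∞ :=
  (∑' t : ℕ, (2 * t + 1) * idlaTail K ν A t) - (idlaMean K ν A) ^ 2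

/-! ### The ARW chain -/

/-- The state of a single site: empty, one sleeping particle, or `n+1` active particles. -/
inductive Site : Type
  | empty : Site
  | sleeping : Site
  | active (n : ℕ) : Site
deriving DecidableEq

/-- A configuration of particles. -/
abbrev Conf (V : Type) := V → Site

def Site.isActive : Site → Bool
  | .active _ => true
  | _ => false

/-- The set of sites holding at least one active particle. -/
def activeSites (η : Conf V) : Finset V := Finset.univ.filter fun x => (η x).isActive

/-- Adding one active particle to a site (waking a sleeping particle if present). -/
def Site.addActive : Site → Site
  | .empty => .active 0
  | .sleeping => .active 1
  | .active n => .active (n + 1)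

/-- Removing one active particle from a site. -/
def Site.removeOne : Site → Site
  | .active (n + 1) => .active n
  | _ => .empty

/-- Adding one active particle at site `y`. -/
def addActiveAt (η : Conf V) (y : V) : Conf V := Function.update η y (η y).addActive

/-- One sequential toppling step of ARW stabilization with sleep rate `lam`:
an active site `x` is selected (if any); if its particle is alone it falls asleep
with probability `lam/(1+lam)`, moves to `y` with probability `K x y/(1+lam)` and
dies with the remaining probability; if it is not alone it moves to `y` with
probability `K x y` and dies with the remaining probability.  Stable
configurations are absorbing. -/
noncomputable def toppleKernel (K : V → V → ℝ≥0∞) (lam : ℝ) (η ξ : Conf V) : ℝ≥0∞ :=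
  if h : (activeSites η).Nonempty then
    let x := h.choose
    let ημ : Conf V := Function.update η x (η x).removeOne
    let move : ℝ≥0∞ := ∑ y, if ξ = addActiveAt ημ y then K x y else 0
    let die : ℝ≥0∞ := if ξ = ημ then 1 - ∑ y, K x y else 0
    if η x = Site.active 0 then
      ((if ξ = Function.update η x Site.sleeping then ENNReal.ofReal lam else 0) + move + die)
        / (ENNReal.ofReal lam + 1)
    else move + die
  else if ξ = η then 1 else 0

/-- Iterates of a sub-probability kernel on configurations. -/
noncomputable def kernelPow (M : Conf V → Conf V → ℝ≥0∞) : ℕ → Conf V → Conf V → ℝ≥0∞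
  | 0 => fun η ξ => if ξ = η then 1 else 0
  | t + 1 => fun η ξ => ∑' σ : Conf V, M η σ * kernelPow M t σ ξ

/-- A stable configuration, seen as a configuration (`true` = sleeping particle). -/
def embed (b : V → Bool) : Conf V := fun x => if b x then Site.sleeping else Site.empty

/-- One step of the `ARW(K,lam,ν)` chain: insert an active particle at a `ν`-distributed
site and stabilize; `arwStep K lam ν η ξ` is the probability of reaching the stable
configuration `ξ` from the stable configuration `η`. -/
noncomputable def arwStep (K : V → V → ℝ≥0∞) (lam : ℝ) (ν : V → ℝ≥0∞)
    (η ξ : V → Bool) : ℝ≥0∞ :=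
  ∑ x, ν x * ⨆ t, kernelPow (toppleKernel K lam) t (addActiveAt (embed η) x) (embed ξ)

/-- The transition matrix of the `ARW(K,lam,ν)` chain on stable configurations. -/
noncomputable def arwMatrix (K : V → V → ℝ≥0∞) (lam : ℝ) (ν : V → ℝ≥0∞) :
    Matrix (V → Bool) (V → Bool) ℝ :=
  Matrix.of fun η ξ => (arwStep K lam ν η ξ).toReal

/-! ### Distances to equilibrium, mixing and relaxation times -/

variable {S : Type} [Fintype S] [DecidableEq S]

/-- `π` is a stationary probability distribution for `P`. -/
def IsStationary (P : Matrix S S ℝ) (π : S → ℝ) : Prop :=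
  (∀ s, 0 ≤ π s) ∧ (∑ s, π s = 1) ∧ ∀ s, ∑ r, π r * P r s = π s

/-- The separation distance to equilibrium at time `t`. -/
noncomputable def sepDist (P : Matrix S S ℝ) (π : S → ℝ) (t : ℕ) : ℝ :=
  ⨆ η, ⨆ ξ, (1 - (P ^ t) η ξ / π ξ)

/-- The separation mixing time with precision `ε`. -/
noncomputable def sepMix (P : Matrix S S ℝ) (π : S → ℝ) (ε : ℝ) : ℕ :=
  sInf {t : ℕ | sepDist P π t ≤ ε}

/-- The total-variation distance to equilibrium at time `t`. -/
noncomputable def tvDist (P : Matrix S S ℝ) (π : S → ℝ) (t : ℕ) : ℝ :=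
  ⨆ η, ⨆ A : Finset S, |∑ ξ ∈ A, ((P ^ t) η ξ - π ξ)|

/-- The total-variation mixing time with precision `ε`. -/
noncomputable def tvMix (P : Matrix S S ℝ) (π : S → ℝ) (ε : ℝ) : ℕ :=
  sInf {t : ℕ | tvDist P π t ≤ ε}

/-- The relaxation time `1/(1-ρ)`, where `ρ` is the largest modulus of the
(complex) eigenvalues of `P` other than `1`. -/
noncomputable def relTime (P : Matrix S S ℝ) : ℝ :=
  (1 - sSup {r : ℝ | ∃ z : ℂ,
      z ≠ 1 ∧ (P.map (fun a : ℝ => (a : ℂ))).charpoly.IsRoot z ∧ r = ‖z‖})⁻¹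

/-- Separation (or total-variation) cutoff for a sequence of chains with distance
functions `d n` and mixing times `ts n`. -/
def HasCutoff (d : ℕ → ℕ → ℝ) (ts : ℕ → ℕ) : Prop :=
  ∀ α : ℝ, 0 ≤ α →
    (α < 1 → Tendsto (fun n => d n ⌊α * (ts n : ℝ)⌋₊) atTop (nhds 1)) ∧
    (1 < α → Tendsto (fun n => d n ⌊α * (ts n : ℝ)⌋₊) atTop (nhds 0))

end ARW


set_option linter.unusedSectionVars false

namespace ARW

section Core
variable {V : Type} [Fintype V] [DecidableEq V]

def Site.sleepOne : Site → Site
  | .active 0 => .sleeping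
  | s => s

def rem (η : Conf V) (x : V) : Conf V := Function.update η x (η x).removeOne
def slp (η : Conf V) (x : V) : Conf V := Function.update η x (η x).sleepOne

def act (x : V) : Option (Option V) → Conf V → Conf V
  | none, η => slp η x
  | some none, η => rem η x
  | some (some y), η => addActiveAt (rem η x) y

noncomputable def wt (K : V → V → ℝ≥0∞) (l : ℝ≥0∞) (x : V) : Option (Option V) → ℝ≥0∞
  | none => l / (l + 1)
  | some none => (1 - ∑ y, K x y) / (l + 1)
  | some (some y) => K x y / (l + 1)

noncomputable def mv (K : V → V → ℝ≥0∞) (x : V) (F : Conf V → ℝ≥0∞) (η : Conf V) : ℝ≥0∞ :=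
  (∑ y, K x y * F (addActiveAt (rem η x) y)) + (1 - ∑ y, K x y) * F (rem η x)

noncomputable def lz (K : V → V → ℝ≥0∞) (l : ℝ≥0∞) (x : V) (F : Conf V → ℝ≥0∞)
    (η : Conf V) : ℝ≥0∞ := ∑ i, wt K l x i * F (act x i η)

lemma lz_eq (K : V → V → ℝ≥0∞) (l : ℝ≥0∞) (x : V) (F : Conf V → ℝ≥0∞) (η : Conf V) :
    lz K l x F η = (l * F (slp η x) + mv K x F η) / (l + 1) := by
  simp only [lz, Fintype.sum_option, wt, act, mv, ENNReal.div_eq_inv_mul, mul_add, Finset.mul_sum,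
    mul_assoc]
  ring

lemma add_comm' (η : Conf V) (z z' : V) :
    addActiveAt (addActiveAt η z) z' = addActiveAt (addActiveAt η z') z := by
  by_cases h : z = z'
  · subst h; rfl
  · unfold addActiveAt
    rw [Function.update_of_ne (Ne.symm h), Function.update_of_ne h, Function.update_comm h]

lemma rem_add {η : Conf V} {x : V} (hx : (η x).isActive = true) (z : V) :
    rem (addActiveAt η z) x = addActiveAt (rem η x) z := by
  unfold rem addActiveAt
  by_cases h : x = z
  · subst h
    simp only [Function.update_self, Function.update_idem]
    congr 1
    rcases hs : η x with _ | _ | n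
    · simp [hs, Site.isActive] at hx
    · simp [hs, Site.isActive] at hx
    · cases n <;> rfl
  · rw [Function.update_of_ne h, Function.update_of_ne (Ne.symm h), Function.update_comm h]

lemma slp_add {η : Conf V} {x : V} (hx : (η x).isActive = true) (z : V) :
    slp (addActiveAt η z) x = addActiveAt (slp η x) z := by
  unfold slp addActiveAt
  by_cases h : x = z
  · subst h
    simp only [Function.update_self, Function.update_idem]
    congr 1
    rcases hs : η x with _ | _ | n
    · simp [hs, Site.isActive] at hx
    · simp [hs, Site.isActive] at hx
    · cases n <;> rfl
  · rw [Function.update_of_ne h, Function.update_of_ne (Ne.symm h), Function.update_comm h]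

lemma act_add {η : Conf V} {x : V} (hx : (η x).isActive = true) (i : Option (Option V)) (z : V) :
    act x i (addActiveAt η z) = addActiveAt (act x i η) z := by
  rcases i with _ | _ | y
  · exact slp_add hx z
  · exact rem_add hx z
  · simp only [act]; rw [rem_add hx, add_comm']

lemma active_add {η : Conf V} {x : V} (hx : (η x).isActive = true) (z : V) :
    ((addActiveAt η z) x).isActive = true := by
  unfold addActiveAt
  by_cases h : x = z
  · subst h
    simp only [Function.update_self]
    rcases hs : η x with _ | _ | n <;> rfl
  · rw [Function.update_of_ne h]; exact hx

lemma active_act {η : Conf V} {x y : V} (h : x ≠ y) (hy : (η y).isActive = true)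
    (i : Option (Option V)) : ((act x i η) y).isActive = true := by
  rcases i with _ | _ | z
  · simp only [act, slp]; rw [Function.update_of_ne (Ne.symm h)]; exact hy
  · simp only [act, rem]; rw [Function.update_of_ne (Ne.symm h)]; exact hy
  · simp only [act]; apply active_add
    simp only [rem]; rw [Function.update_of_ne (Ne.symm h)]; exact hy

lemma act_act {η : Conf V} {x y : V} (h : x ≠ y) (hx : (η x).isActive = true)
    (hy : (η y).isActive = true) (i j : Option (Option V)) :
    act y j (act x i η) = act x i (act y j η) := by
  have hb : ∀ i : Option (Option V), i = none ∨ i = some none →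
      ∀ j : Option (Option V), j = none ∨ j = some none →
      act y j (act x i η) = act x i (act y j η) := by
    rintro i (rfl | rfl) j (rfl | rfl) <;> simp only [act, slp, rem] <;>
      rw [Function.update_of_ne (Ne.symm h), Function.update_of_ne h, Function.update_comm h]
  have hb2 : ∀ i : Option (Option V), i = none ∨ i = some none → ∀ j,
      act y j (act x i η) = act x i (act y j η) := by
    intro i hi j
    rcases j with _ | _ | z
    · exact hb i hi _ (by simp)
    · exact hb i hi _ (by simp)
    · change addActiveAt (act y (some none) (act x i η)) z
        = act x i (addActiveAt (act y (some none) η) z)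
      rw [act_add (active_act (Ne.symm h) hx _), hb i hi _ (by simp)]
  rcases i with _ | _ | z
  · exact hb2 _ (by simp) _
  · exact hb2 _ (by simp) _
  · change act y j (addActiveAt (act x (some none) η) z)
        = addActiveAt (act x (some none) (act y j η)) z
    rw [act_add (active_act h hy _), hb2 _ (by simp)]

variable (K : V → V → ℝ≥0∞) (l : ℝ≥0∞)

lemma lz_comm (F : Conf V → ℝ≥0∞) {η : Conf V} {x y : V} (h : x ≠ y)
    (hx : (η x).isActive = true) (hy : (η y).isActive = true) :
    lz K l x (lz K l y F) η = lz K l y (lz K l x F) η := by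
  simp only [lz, Finset.mul_sum]
  rw [Finset.sum_comm]
  refine Finset.sum_congr rfl fun j _ => Finset.sum_congr rfl fun i _ => ?_
  rw [act_act h hx hy]; ring

lemma lz_mono {F G : Conf V → ℝ≥0∞} {η : Conf V} {x : V}
    (h : ∀ i, F (act x i η) ≤ G (act x i η)) : lz K l x F η ≤ lz K l x G η :=
  Finset.sum_le_sum fun i _ => mul_le_mul_right (h i) _

variable {K} in
lemma wt_sum (hsub : SubStochastic K) (hl : l ≠ ⊤) (x : V) : ∑ i, wt K l x i = 1 := by
  simp only [Fintype.sum_option, wt, ENNReal.div_eq_inv_mul, ← Finset.mul_sum, ← mul_add]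
  rw [tsub_add_cancel_of_le (hsub x)]
  exact ENNReal.inv_mul_cancel (by simp) (by simp [hl])

/-- optimal value -/
noncomputable def qk (b : V → Bool) : ℕ → Conf V → ℝ≥0∞
  | 0 => fun η => if η = embed b then 1 else 0
  | k + 1 => fun η => if (activeSites η).Nonempty then
      (activeSites η).sup (fun x => lz K l x (qk b k) η) else if η = embed b then 1 else 0

lemma mem_active {η : Conf V} {x : V} : x ∈ activeSites η ↔ (η x).isActive = true := by
  simp [activeSites]

lemma embed_inactive (b : V → Bool) (x : V) : ((embed b) x).isActive = false := by
  unfold embed; split <;> rfl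

lemma embed_stable (b : V → Bool) : ¬ (activeSites (embed b)).Nonempty := by
  rintro ⟨x, hx⟩
  rw [mem_active, embed_inactive] at hx; cases hx

lemma lz_le_qk (b : V → Bool) (k : ℕ) {η : Conf V} {x : V} (hx : (η x).isActive = true) :
    lz K l x (qk K l b k) η ≤ qk K l b (k+1) η := by
  have h1 : (activeSites η).Nonempty := ⟨x, mem_active.2 hx⟩
  simp only [qk, if_pos h1]
  exact Finset.le_sup (f := fun x => lz K l x (qk K l b k) η) (mem_active.2 hx)

lemma qk_zero_of_active (b : V → Bool) {η : Conf V} {x : V} (hx : (η x).isActive = true) :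
    qk K l b 0 η = 0 := by
  simp only [qk]
  rw [if_neg]
  rintro rfl
  rw [embed_inactive] at hx; cases hx

lemma qk_succ_le (b : V → Bool) (k : ℕ) {η : Conf V} {B : ℝ≥0∞} (h : (activeSites η).Nonempty)
    (hB : ∀ x, (η x).isActive = true → lz K l x (qk K l b k) η ≤ B) : qk K l b (k+1) η ≤ B := by
  simp only [qk, if_pos h]
  exact Finset.sup_le fun x hx => hB x (mem_active.1 hx)

lemma qk_stable (b : V → Bool) (k : ℕ) {η : Conf V} (h : ¬ (activeSites η).Nonempty) :
    qk K l b k η = if η = embed b then 1 else 0 := by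
  cases k
  · rfl
  · simp only [qk, if_neg h]

lemma qk_mono_succ (b : V → Bool) (k : ℕ) (η : Conf V) : qk K l b k η ≤ qk K l b (k+1) η := by
  induction k generalizing η with
  | zero =>
    by_cases h : (activeSites η).Nonempty
    · obtain ⟨x, hx⟩ := h
      rw [qk_zero_of_active K l b (mem_active.1 hx)]; exact zero_le
    · rw [qk_stable K l b _ h, qk_stable K l b _ h]
  | succ k ih =>
    by_cases h : (activeSites η).Nonempty
    · exact qk_succ_le K l b k h fun x hx =>
        (lz_mono K l fun i => ih _).trans (lz_le_qk K l b (k+1) hx)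
    · rw [qk_stable K l b _ h, qk_stable K l b _ h]

lemma qk_mono (b : V → Bool) (η : Conf V) : Monotone fun k => qk K l b k η :=
  monotone_nat_of_le_succ fun k => qk_mono_succ K l b k η

lemma qk_le_lz (b : V → Bool) (k : ℕ) {η : Conf V} {x : V} (hx : (η x).isActive = true) :
    qk K l b k η ≤ lz K l x (qk K l b k) η := by
  induction k generalizing η x with
  | zero => rw [qk_zero_of_active K l b hx]; exact zero_le
  | succ k ih =>
    refine qk_succ_le K l b k ⟨x, mem_active.2 hx⟩ fun y hy => ?_
    by_cases h : y = x
    · subst h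
      exact lz_mono K l fun i => qk_mono_succ K l b k _
    · calc lz K l y (qk K l b k) η ≤ lz K l y (lz K l x (qk K l b k)) η :=
            lz_mono K l fun i => ih (active_act h hx i)
        _ = lz K l x (lz K l y (qk K l b k)) η := lz_comm K l _ h hy hx
        _ ≤ _ := lz_mono K l fun i => lz_le_qk K l b k (active_act (Ne.symm h) hy i)

variable {K l} in
lemma lz_const_le (hsub : SubStochastic K) (hl : l ≠ ⊤) {F : Conf V → ℝ≥0∞} {B : ℝ≥0∞}
    (hF : ∀ η, F η ≤ B) (x : V) (η : Conf V) : lz K l x F η ≤ B := by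
  calc lz K l x F η ≤ ∑ i, wt K l x i * B := Finset.sum_le_sum fun i _ => mul_le_mul_right (hF _) _
    _ = B := by rw [← Finset.sum_mul, wt_sum l hsub hl, one_mul]

variable {K l} in
lemma qk_le_one (hsub : SubStochastic K) (hl : l ≠ ⊤) (b : V → Bool) (k : ℕ) (η : Conf V) :
    qk K l b k η ≤ 1 := by
  induction k generalizing η with
  | zero => simp only [qk]; split <;> simp
  | succ k ih =>
    by_cases h : (activeSites η).Nonempty
    · exact qk_succ_le K l b k h fun x hx => lz_const_le hsub hl ih x η
    · rw [qk_stable K l b _ h]; split <;> simp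

noncomputable def Qv (b : V → Bool) (η : Conf V) : ℝ≥0∞ := ⨆ k, qk K l b k η

lemma lz_iSup (b : V → Bool) (x : V) (η : Conf V) :
    lz K l x (Qv K l b) η = ⨆ k, lz K l x (qk K l b k) η := by
  simp only [lz, Qv, ENNReal.mul_iSup]
  rw [ENNReal.finsetSum_iSup_of_monotone]
  intro i j k hjk
  exact mul_le_mul_right (qk_mono K l b _ hjk) _

lemma Qv_lz (b : V → Bool) {η : Conf V} {x : V} (hx : (η x).isActive = true) :
    lz K l x (Qv K l b) η = Qv K l b η := by
  rw [lz_iSup]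
  apply le_antisymm
  · exact iSup_le fun k => (lz_le_qk K l b k hx).trans (le_iSup (fun k => qk K l b k η) (k+1))
  · exact iSup_mono fun k => qk_le_lz K l b k hx

lemma Qv_embed (b b' : V → Bool) : Qv K l b (embed b') = if embed b' = embed b then 1 else 0 := by
  simp only [Qv, qk_stable K l b _ (embed_stable b')]
  exact iSup_const

variable {K l} in
lemma Qv_le_one (hsub : SubStochastic K) (hl : l ≠ ⊤) (b : V → Bool) (η : Conf V) :
    Qv K l b η ≤ 1 := iSup_le fun k => qk_le_one hsub hl b k η

lemma slp_eq_self {η : Conf V} {x : V} (h : η x ≠ Site.active 0) : slp η x = η := by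
  unfold slp
  have : (η x).sleepOne = η x := by
    rcases hs : η x with _ | _ | n
    · rfl
    · rfl
    · cases n
      · exact absurd hs h
      · rfl
  rw [this, Function.update_eq_self]

lemma ediv_eq_iff {a b c : ℝ≥0∞} (h0 : b ≠ 0) (h1 : b ≠ ⊤) : a / b = c ↔ a = c * b := by
  constructor
  · rintro rfl; exact (ENNReal.div_mul_cancel h0 h1).symm
  · rintro rfl; exact ENNReal.mul_div_cancel_right h0 h1

/-- harmonic for lazy toppling implies harmonic for the move operator -/
lemma mv_of_lz (hl : l ≠ ⊤) {F : Conf V → ℝ≥0∞} {η : Conf V} {x : V} (hF : F η ≠ ⊤)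
    (h : lz K l x F η = F η) (hn : η x ≠ Site.active 0) : mv K x F η = F η := by
  rw [lz_eq, slp_eq_self hn, ediv_eq_iff (by simp) (by simp [hl])] at h
  have h2 : l * F η + mv K x F η = l * F η + F η := by rw [h]; ring
  exact (ENNReal.add_right_inj (ENNReal.mul_ne_top hl hF)).1 h2

lemma lz_of_mv (hl : l ≠ ⊤) {F : Conf V → ℝ≥0∞} {η : Conf V} {x : V}
    (h : mv K x F η = F η) (hn : η x ≠ Site.active 0) : lz K l x F η = F η := by
  rw [lz_eq, slp_eq_self hn, ediv_eq_iff (by simp) (by simp [hl]), h]; ring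

/-! the chosen kernel -/

noncomputable def mop (lam : ℝ) (F : Conf V → ℝ≥0∞) (η : Conf V) : ℝ≥0∞ :=
  ∑' σ, toppleKernel K lam η σ * F σ

lemma mop_stable (lam : ℝ) (F : Conf V → ℝ≥0∞) {η : Conf V} (h : ¬ (activeSites η).Nonempty) :
    mop K lam F η = F η := by
  simp only [mop, toppleKernel, dif_neg h]
  rw [tsum_eq_single η]
  · simp
  · intro σ hσ; simp [hσ]

lemma tsum_ite_mul (a : Conf V) (c : ℝ≥0∞) (F : Conf V → ℝ≥0∞) :
    ∑' σ, (if σ = a then c else 0) * F σ = c * F a := by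
  rw [tsum_eq_single a]
  · simp
  · intro σ hσ; simp [hσ]

lemma mop_active (lam : ℝ) (F : Conf V → ℝ≥0∞) {η : Conf V} (h : (activeSites η).Nonempty) :
    mop K lam F η = if η h.choose = Site.active 0 then lz K (ENNReal.ofReal lam) h.choose F η
      else mv K h.choose F η := by
  have hmv : ∀ x, ∑' σ, ((∑ y, if σ = addActiveAt (rem η x) y then K x y else 0)
      + (if σ = rem η x then 1 - ∑ y, K x y else 0)) * F σ
      = mv K x F η := by
    intro x
    simp only [add_mul, Finset.sum_mul]
    rw [ENNReal.tsum_add, Summable.tsum_finsetSum (fun _ _ => ENNReal.summable)]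
    simp only [tsum_ite_mul, mv]
  simp only [mop, toppleKernel, dif_pos h]
  generalize Exists.choose h = x
  split_ifs with h0
  · rw [lz_eq, ← hmv]
    have : slp η x = Function.update η x Site.sleeping := by
      unfold slp; rw [h0]; rfl
    rw [this, ← tsum_ite_mul, ← ENNReal.tsum_add, ENNReal.div_eq_inv_mul, ← ENNReal.tsum_mul_left]
    refine tsum_congr fun σ => ?_
    rw [ENNReal.div_eq_inv_mul, mul_assoc, ← add_mul, ← add_assoc]
    rfl
  · rw [← hmv]; rfl

lemma mop_add (lam : ℝ) (F G : Conf V → ℝ≥0∞) :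
    mop K lam (fun σ => F σ + G σ) = fun η => mop K lam F η + mop K lam G η := by
  funext η; simp only [mop, mul_add, ENNReal.tsum_add]

lemma mop_smul (lam : ℝ) (c : ℝ≥0∞) (F : Conf V → ℝ≥0∞) :
    mop K lam (fun σ => c * F σ) = fun η => c * mop K lam F η := by
  funext η; simp only [mop]; rw [← ENNReal.tsum_mul_left]
  exact tsum_congr fun σ => by ring

lemma mop_sum (lam : ℝ) {ι : Type} (s : Finset ι) (F : ι → Conf V → ℝ≥0∞) :
    mop K lam (fun σ => ∑ i ∈ s, F i σ) = fun η => ∑ i ∈ s, mop K lam (F i) η := by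
  funext η; simp only [mop, Finset.mul_sum]
  exact Summable.tsum_finsetSum (fun _ _ => ENNReal.summable)

lemma mop_mono (lam : ℝ) {F G : Conf V → ℝ≥0∞} (h : F ≤ G) : mop K lam F ≤ mop K lam G :=
  fun η => ENNReal.tsum_le_tsum fun σ => mul_le_mul_right (h σ) _

noncomputable def kp (lam : ℝ) (b : V → Bool) (t : ℕ) (η : Conf V) : ℝ≥0∞ :=
  kernelPow (toppleKernel K lam) t η (embed b)

lemma kp_eq (lam : ℝ) (b : V → Bool) (t : ℕ) :
    kp K lam b t = (mop K lam)^[t] (fun η => if embed b = η then 1 else 0) := by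
  induction t with
  | zero => rfl
  | succ t ih =>
    rw [Function.iterate_succ_apply', ← ih]; rfl

end Core
end ARW

set_option linter.unusedSectionVars false

namespace ARW

section Net
variable {V : Type} [Fintype V] [DecidableEq V] {K : V → V → ℝ≥0∞}

lemma K_ne_top (hsub : SubStochastic K) (x y : V) : K x y ≠ ⊤ := by
  have h1 : K x y ≤ ∑ y, K x y := Finset.single_le_sum (fun _ _ => zero_le) (Finset.mem_univ y)
  exact ne_top_of_le_ne_top ENNReal.one_ne_top (h1.trans (hsub x))

lemma k_sum_le (hsub : SubStochastic K) (x : V) : ∑ y, (K x y).toReal ≤ 1 := by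
  rw [← ENNReal.toReal_sum (fun y _ => K_ne_top hsub x y)]
  exact ENNReal.toReal_le_of_le_ofReal zero_le_one (by simpa using hsub x)

lemma no_stoch (hsub : SubStochastic K) (hnd : NonDegenerate K) (S : Finset V) (hS : S.Nonempty)
    (h : ∀ x ∈ S, ∑ y ∈ S, (K x y).toReal = 1) : False := by
  obtain ⟨x, hx, hne⟩ := hnd S hS
  apply hne
  have h1 := h x hx
  rw [← ENNReal.toReal_sum (fun y _ => K_ne_top hsub x y)] at h1
  rwa [ENNReal.toReal_eq_one_iff] at h1

lemma kill_unique (hsub : SubStochastic K) (hnd : NonDegenerate K) (v : V → ℝ)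
    (hv : ∀ x, v x = 0 ∨ v x = ∑ y, (K x y).toReal * v y) (x : V) : v x = 0 := by
  by_contra hx
  obtain ⟨z, -, hz⟩ := Finset.exists_max_image Finset.univ (fun y => |v y|) ⟨x, Finset.mem_univ x⟩
  have hz' : ∀ y, |v y| ≤ |v z| := fun y => hz y (Finset.mem_univ y)
  set m := |v z| with hm
  have hmpos : 0 < m := lt_of_lt_of_le (abs_pos.2 hx) (hz' x)
  refine no_stoch hsub hnd (Finset.univ.filter fun y => |v y| = m) ⟨z, by simp [hm]⟩ ?_
  intro u hu
  have hu' : |v u| = m := by simpa using hu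
  have hk : ∀ y, 0 ≤ (K u y).toReal := fun y => ENNReal.toReal_nonneg
  rcases hv u with h0 | h1
  · rw [h0, abs_zero] at hu'; linarith
  have h2 : m ≤ ∑ y, (K u y).toReal * |v y| := by
    rw [← hu', h1]
    refine (Finset.abs_sum_le_sum_abs _ _).trans (le_of_eq ?_)
    exact Finset.sum_congr rfl fun y _ => by rw [abs_mul, abs_of_nonneg (hk y)]
  have h3 := k_sum_le hsub u
  have h4 : ∑ y, (K u y).toReal * (m - |v y|) = (∑ y, (K u y).toReal) * m
      - ∑ y, (K u y).toReal * |v y| := by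
    simp only [mul_sub, Finset.sum_sub_distrib, Finset.sum_mul]
  have h5 : ∀ y ∈ Finset.univ, 0 ≤ (K u y).toReal * (m - |v y|) := fun y _ =>
    mul_nonneg (hk y) (sub_nonneg.2 (hz' y))
  have h6 : (∑ y, (K u y).toReal) * m ≤ m := by nlinarith
  have h7 : ∑ y, (K u y).toReal * (m - |v y|) = 0 :=
    le_antisymm (by linarith) (Finset.sum_nonneg h5)
  have h8 := (Finset.sum_eq_zero_iff_of_nonneg h5).1 h7
  have h9 : ∑ y, (K u y).toReal = 1 := by
    have : (∑ y, (K u y).toReal) * m = 1 * m := by linarith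
    exact mul_right_cancel₀ hmpos.ne' this
  rw [← h9]
  refine Finset.sum_subset (Finset.subset_univ _) ?_
  intro y _ hy
  have hy' : |v y| ≠ m := by simpa using hy
  rcases mul_eq_zero.1 (h8 y (Finset.mem_univ y)) with h | h
  · exact h
  · exact absurd (by linarith) hy'

lemma green (hsub : SubStochastic K) (hnd : NonDegenerate K) :
    ∃ g : V → ℝ≥0∞, (∀ x, g x ≠ ⊤) ∧ ∀ x, 1 + ∑ y, K x y * g y ≤ g x := by
  let L : (V → ℝ) →ₗ[ℝ] (V → ℝ) :=
    LinearMap.id - Matrix.mulVecLin (Matrix.of fun x y => (K x y).toReal)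
  have hL : ∀ v x, L v x = v x - ∑ y, (K x y).toReal * v y := by
    intro v x; simp [L, Matrix.mulVec, dotProduct]
  have hinj : Function.Injective L := by
    rw [injective_iff_map_eq_zero]
    intro v hv
    funext x
    refine kill_unique hsub hnd v (fun x => Or.inr ?_) x
    have := congrFun hv x
    rw [hL] at this
    simp at this; linarith
  obtain ⟨g, hg⟩ := (LinearMap.injective_iff_surjective.1 hinj) (fun _ => 1)
  have hg' : ∀ x, g x = 1 + ∑ y, (K x y).toReal * g y := by
    intro x
    have := congrFun hg x
    rw [hL] at this
    linarith
  have hpos : ∀ x, 0 ≤ g x := by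
    intro x
    obtain ⟨z, -, hz⟩ := Finset.exists_min_image Finset.univ g ⟨x, Finset.mem_univ x⟩
    refine le_trans ?_ (hz x (Finset.mem_univ x))
    by_contra hneg
    push Not at hneg
    have h1 : ∑ y, (K z y).toReal * g z ≤ ∑ y, (K z y).toReal * g y :=
      Finset.sum_le_sum fun y _ => mul_le_mul_of_nonneg_left (hz y (Finset.mem_univ y))
        ENNReal.toReal_nonneg
    rw [← Finset.sum_mul] at h1
    have := k_sum_le hsub z
    have := hg' z
    nlinarith
  refine ⟨fun x => ENNReal.ofReal (g x), fun x => ENNReal.ofReal_ne_top, fun x => ?_⟩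
  apply le_of_eq
  change 1 + ∑ y, K x y * ENNReal.ofReal (g y) = ENNReal.ofReal (g x)
  rw [hg' x, ENNReal.ofReal_add zero_le_one
    (Finset.sum_nonneg fun y _ => mul_nonneg ENNReal.toReal_nonneg (hpos y)),
    ENNReal.ofReal_sum_of_nonneg (fun y _ => mul_nonneg ENNReal.toReal_nonneg (hpos y)),
    ENNReal.ofReal_one]
  congr 1
  refine Finset.sum_congr rfl fun y _ => ?_
  rw [ENNReal.ofReal_mul ENNReal.toReal_nonneg, ENNReal.ofReal_toReal (K_ne_top hsub x y)]

end Net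

section Term
variable {V : Type} [Fintype V] [DecidableEq V] (K : V → V → ℝ≥0∞)

noncomputable def Site.cn : Site → ℝ≥0∞
  | .empty => 0
  | .sleeping => 1
  | .active n => n + 1
noncomputable def Site.ac : Site → ℝ≥0∞
  | .empty => 0
  | .sleeping => 0
  | .active n => n + 1

noncomputable def stw (g : V → ℝ≥0∞) (x : V) (s : Site) : ℝ≥0∞ := s.cn * (2 * g x) + s.ac

noncomputable def psi (g : V → ℝ≥0∞) (η : Conf V) : ℝ≥0∞ := ∑ x, stw g x (η x)

lemma psi_split (g : V → ℝ≥0∞) (η : Conf V) (x : V) :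
    psi g η = stw g x (η x) + ∑ y ∈ Finset.univ.erase x, stw g y (η y) :=
  (Finset.add_sum_erase _ _ (Finset.mem_univ x)).symm

lemma psi_update (g : V → ℝ≥0∞) (η : Conf V) (x : V) (s : Site) :
    psi g (Function.update η x s) = stw g x s + ∑ y ∈ Finset.univ.erase x, stw g y (η y) := by
  rw [psi_split g _ x, Function.update_self]
  congr 1
  exact Finset.sum_congr rfl fun y hy => by rw [Function.update_of_ne (Finset.ne_of_mem_erase hy)]

lemma psi_rem (g : V → ℝ≥0∞) {η : Conf V} {x : V} (hx : (η x).isActive = true) :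
    psi g (rem η x) + 2 * g x + 1 = psi g η := by
  rw [rem, psi_update, psi_split g η x]
  rcases hs : η x with _ | _ | n
  · simp [hs, Site.isActive] at hx
  · simp [hs, Site.isActive] at hx
  · cases n with
    | zero => simp only [Site.removeOne, stw, Site.cn, Site.ac]; push_cast; ring
    | succ n => simp only [Site.removeOne, stw, Site.cn, Site.ac]; push_cast; ring

lemma psi_slp (g : V → ℝ≥0∞) {η : Conf V} {x : V} (hx : η x = Site.active 0) :
    psi g (slp η x) + 1 = psi g η := by
  rw [slp, psi_update, psi_split g η x, hx]
  simp only [Site.sleepOne, stw, Site.cn, Site.ac]; push_cast; ring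

lemma psi_add (g : V → ℝ≥0∞) (η : Conf V) (y : V) :
    psi g (addActiveAt η y) ≤ psi g η + 2 * g y + 2 := by
  rw [addActiveAt, psi_update, psi_split g η y]
  have : stw g y (η y).addActive ≤ stw g y (η y) + 2 * g y + 2 := by
    rcases hs : η y with _ | _ | n
    · simp only [Site.addActive, stw, Site.cn, Site.ac]
      simp only [Nat.cast_zero, zero_add, zero_mul, one_mul]; gcongr; norm_num
    · simp only [Site.addActive, stw, Site.cn, Site.ac]
      apply le_of_eq; push_cast; ring
    · simp only [Site.addActive, stw, Site.cn, Site.ac]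
      calc _ = (n + 1 : ℝ≥0∞) * (2 * g y) + (n + 1) + 2 * g y + 1 := by push_cast; ring
        _ ≤ _ := by gcongr; norm_num
  calc _ ≤ (stw g y (η y) + 2 * g y + 2) + ∑ y ∈ Finset.univ.erase y, stw g y (η y) := by gcongr
    _ = _ := by ring

lemma psi_ne_top {g : V → ℝ≥0∞} (hg : ∀ x, g x ≠ ⊤) (η : Conf V) : psi g η ≠ ⊤ := by
  refine ENNReal.sum_ne_top.2 fun x _ => ?_
  unfold stw
  rcases η x with _ | _ | n <;> simp [Site.cn, Site.ac, ENNReal.mul_eq_top, hg]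

variable {K}

lemma mv_psi (hsub : SubStochastic K) {g : V → ℝ≥0∞} (hg : ∀ x, 1 + ∑ y, K x y * g y ≤ g x)
    {η : Conf V} {x : V} (hx : (η x).isActive = true) : mv K x (psi g) η + 1 ≤ psi g η := by
  rw [← psi_rem g hx]
  gcongr
  unfold mv
  set r := rem η x
  calc _ ≤ ∑ y, K x y * (psi g r + 2 * g y + 2) + (1 - ∑ y, K x y) * psi g r := by
        gcongr with y; exact psi_add g r y
    _ = (∑ y, K x y + (1 - ∑ y, K x y)) * psi g r + 2 * (∑ y, K x y * g y) + 2 * ∑ y, K x y := by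
        simp only [mul_add, Finset.sum_add_distrib, add_mul, ← Finset.sum_mul, Finset.mul_sum]
        simp only [← Finset.mul_sum, ← Finset.sum_mul]
        have : ∑ x_1, K x x_1 * (2 * g x_1) = ∑ i, 2 * (K x i * g i) :=
          Finset.sum_congr rfl fun y _ => by ring
        rw [this, ← Finset.mul_sum]
        ring
    _ ≤ psi g r + 2 * (∑ y, K x y * g y) + 2 * 1 := by
        rw [add_tsub_cancel_of_le (hsub x), one_mul]
        gcongr; exact hsub x
    _ = psi g r + 2 * (1 + ∑ y, K x y * g y) := by ring
    _ ≤ _ := by gcongr; exact hg x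

lemma lz_psi (hsub : SubStochastic K) {l : ℝ≥0∞} (hl : l ≠ ⊤)
    {g : V → ℝ≥0∞} (hg : ∀ x, 1 + ∑ y, K x y * g y ≤ g x)
    {η : Conf V} {x : V} (hx : η x = Site.active 0) : lz K l x (psi g) η + 1 ≤ psi g η := by
  have h1 := mv_psi hsub hg (η := η) (x := x) (by rw [hx]; rfl)
  have h2 := psi_slp g hx
  rw [lz_eq]
  have h3 : (1 : ℝ≥0∞) = (l + 1) / (l + 1) := (ENNReal.div_self (by simp) (by simp [hl])).symm
  nth_rewrite 2 [h3]
  rw [ENNReal.div_add_div_same]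
  apply ENNReal.div_le_of_le_mul
  calc _ = l * (psi g (slp η x) + 1) + (mv K x (psi g) η + 1) := by ring
    _ ≤ l * psi g η + psi g η := by rw [h2]; gcongr
    _ = _ := by ring

lemma mop_psi (hsub : SubStochastic K) (lam : ℝ)
    {g : V → ℝ≥0∞} (hg : ∀ x, 1 + ∑ y, K x y * g y ≤ g x)
    {η : Conf V} (h : (activeSites η).Nonempty) : mop K lam (psi g) η + 1 ≤ psi g η := by
  rw [mop_active K lam _ h]
  split_ifs with h0
  · exact lz_psi hsub ENNReal.ofReal_ne_top hg h0
  · exact mv_psi hsub hg (mem_active.1 h.choose_spec)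

noncomputable def unst (η : Conf V) : ℝ≥0∞ := if (activeSites η).Nonempty then 1 else 0

variable (K)
lemma mopit_add (lam : ℝ) (t : ℕ) (F G : Conf V → ℝ≥0∞) :
    (mop K lam)^[t] (fun σ => F σ + G σ) = fun η => (mop K lam)^[t] F η + (mop K lam)^[t] G η := by
  induction t with
  | zero => rfl
  | succ t ih => simp only [Function.iterate_succ_apply', ih, mop_add]

lemma mopit_smul (lam : ℝ) (t : ℕ) (c : ℝ≥0∞) (F : Conf V → ℝ≥0∞) :
    (mop K lam)^[t] (fun σ => c * F σ) = fun η => c * (mop K lam)^[t] F η := by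
  induction t with
  | zero => rfl
  | succ t ih => simp only [Function.iterate_succ_apply', ih, mop_smul]

lemma mopit_sum (lam : ℝ) (t : ℕ) {ι : Type} (s : Finset ι) (F : ι → Conf V → ℝ≥0∞) :
    (mop K lam)^[t] (fun σ => ∑ i ∈ s, F i σ) = fun η => ∑ i ∈ s, (mop K lam)^[t] (F i) η := by
  induction t with
  | zero => rfl
  | succ t ih => simp only [Function.iterate_succ_apply', ih, mop_sum]

lemma mopit_mono (lam : ℝ) (t : ℕ) {F G : Conf V → ℝ≥0∞} (h : F ≤ G) :
    (mop K lam)^[t] F ≤ (mop K lam)^[t] G := by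
  induction t with
  | zero => exact h
  | succ t ih => simp only [Function.iterate_succ_apply']; exact mop_mono K lam ih

variable {K}
lemma unst_sum (hsub : SubStochastic K) (lam : ℝ)
    {g : V → ℝ≥0∞} (hg : ∀ x, 1 + ∑ y, K x y * g y ≤ g x) (t : ℕ) (η : Conf V) :
    ∑ s ∈ Finset.range t, (mop K lam)^[s] unst η + (mop K lam)^[t] (psi g) η ≤ psi g η := by
  induction t with
  | zero => simp
  | succ t ih =>
    refine le_trans ?_ ih
    rw [Finset.sum_range_succ, add_assoc]
    gcongr
    have h1 : (fun σ => unst σ + mop K lam (psi g) σ) ≤ psi g := by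
      intro σ
      by_cases h : (activeSites σ).Nonempty
      · have := mop_psi hsub lam hg h
        simp only [unst, if_pos h]; rwa [add_comm]
      · simp only [unst, if_neg h, zero_add]; rw [mop_stable K lam _ h]
    have h2 := mopit_mono K lam t h1 η
    rw [mopit_add] at h2
    rw [Function.iterate_succ_apply]
    exact h2

lemma unst_tendsto (hsub : SubStochastic K) (hnd : NonDegenerate K) (lam : ℝ) (η : Conf V) :
    Tendsto (fun t => (mop K lam)^[t] unst η) atTop (nhds 0) := by
  obtain ⟨g, hgt, hg⟩ := green hsub hnd
  apply ENNReal.tendsto_atTop_zero_of_tsum_ne_top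
  refine ne_top_of_le_ne_top (psi_ne_top hgt η) ?_
  rw [ENNReal.tsum_eq_iSup_nat]
  exact iSup_le fun t => le_trans le_self_add (unst_sum hsub lam hg t η)

lemma stable_embed {σ : Conf V} (h : ¬ (activeSites σ).Nonempty) : ∃ b, σ = embed b := by
  refine ⟨fun x => decide (σ x = Site.sleeping), ?_⟩
  funext x
  rcases hs : σ x with _ | _ | n
  · simp [embed, hs]
  · simp [embed, hs]
  · exact absurd ⟨x, mem_active.2 (by rw [hs]; rfl)⟩ h

lemma embed_inj {b b' : V → Bool} : embed b = embed b' ↔ b = b' := by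
  constructor
  · intro h
    funext x
    have := congrFun h x
    simp only [embed] at this
    cases hb : b x <;> cases hb' : b' x <;> simp_all
  · rintro rfl; rfl

variable (K) in
noncomputable def Hs (lam : ℝ) (η : Conf V) (b : V → Bool) : ℝ≥0∞ :=
  ⨆ t, kernelPow (toppleKernel K lam) t η (embed b)

lemma kp_succ_ge (lam : ℝ) (b : V → Bool) (t : ℕ) (η : Conf V) :
    kp K lam b t η ≤ kp K lam b (t+1) η := by
  rw [kp_eq, kp_eq, Function.iterate_succ_apply]
  apply mopit_mono
  intro σ
  by_cases h : embed b = σ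
  · subst h
    rw [mop_stable _ _ _ (embed_stable b)]
  · simp [h]

lemma Hs_tendsto (lam : ℝ) (η : Conf V) (b : V → Bool) :
    Tendsto (fun t => kp K lam b t η) atTop (nhds (Hs K lam η b)) :=
  tendsto_atTop_iSup (monotone_nat_of_le_succ fun t => kp_succ_ge lam b t η)

lemma harm_unique (hsub : SubStochastic K) (hnd : NonDegenerate K) (lam : ℝ)
    {F : Conf V → ℝ≥0∞} {B : ℝ≥0∞} (hB : B ≠ ⊤) (hF : ∀ η, F η ≤ B) (h : mop K lam F = F)
    (η : Conf V) : F η = ∑ b, Hs K lam η b * F (embed b) := by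
  have hit : ∀ t, (mop K lam)^[t] F = F := fun t => Function.iterate_fixed h t
  have hlim : Tendsto (fun t => ∑ b, F (embed b) * kp K lam b t η) atTop
      (nhds (∑ b, F (embed b) * Hs K lam η b)) := by
    refine tendsto_finsetSum _ fun b _ => ?_
    exact ENNReal.Tendsto.const_mul (Hs_tendsto lam η b)
      (Or.inr (ne_top_of_le_ne_top hB (hF _)))
  have hlim2 : Tendsto (fun t => ∑ b, F (embed b) * kp K lam b t η + B * (mop K lam)^[t] unst η)
      atTop (nhds (∑ b, F (embed b) * Hs K lam η b + B * 0)) :=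
    hlim.add (ENNReal.Tendsto.const_mul (unst_tendsto hsub hnd lam η) (Or.inr hB))
  rw [mul_zero, add_zero] at hlim2
  have hdec : ∀ t, (mop K lam)^[t] (fun σ => ∑ b, F (embed b) * (if embed b = σ then 1 else 0)) η
      = ∑ b, F (embed b) * kp K lam b t η := by
    intro t
    rw [mopit_sum]
    refine Finset.sum_congr rfl fun b _ => ?_
    rw [mopit_smul, kp_eq]
  have hun : ∀ σ, (activeSites σ).Nonempty →
      ∑ b, F (embed b) * (if embed b = σ then 1 else 0) = 0 := by
    intro σ hσ
    refine Finset.sum_eq_zero fun b _ => ?_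
    rw [if_neg, mul_zero]
    rintro rfl; exact embed_stable b hσ
  have hst : ∀ b', ∑ b, F (embed b) * (if embed b = embed b' then 1 else 0) = F (embed b') := by
    intro b'
    simp [embed_inj]
  have hcomm : ∑ b, Hs K lam η b * F (embed b) = ∑ b, F (embed b) * Hs K lam η b :=
    Finset.sum_congr rfl fun b _ => mul_comm _ _
  rw [hcomm]
  apply le_antisymm
  · refine ge_of_tendsto hlim2 (Eventually.of_forall fun t => ?_)
    rw [← hdec t, ← congrFun (mopit_smul K lam t B unst) η]
    have := congrFun (mopit_add K lam t
      (fun σ => ∑ b, F (embed b) * (if embed b = σ then 1 else 0)) (fun σ => B * unst σ)) η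
    rw [← this]
    conv_lhs => rw [← hit t]
    apply mopit_mono
    intro σ
    by_cases hσ : (activeSites σ).Nonempty
    · simp only [hun σ hσ, unst, if_pos hσ, mul_one, zero_add]; exact hF σ
    · obtain ⟨b', rfl⟩ := stable_embed hσ
      simp only [hst]; exact le_self_add
  · refine le_of_tendsto hlim (Eventually.of_forall fun t => ?_)
    rw [← hdec t]
    conv_rhs => rw [← hit t]
    apply mopit_mono
    intro σ
    by_cases hσ : (activeSites σ).Nonempty
    · simp only [hun σ hσ]; exact zero_le
    · obtain ⟨b', rfl⟩ := stable_embed hσ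
      simp only [hst]; exact le_rfl

lemma mop_of_lz {lam : ℝ} {F : Conf V → ℝ≥0∞} {B : ℝ≥0∞} (hB : B ≠ ⊤) (hF : ∀ η, F η ≤ B)
    (h : ∀ η x, (η x).isActive = true → lz K (ENNReal.ofReal lam) x F η = F η) :
    mop K lam F = F := by
  funext η
  by_cases hη : (activeSites η).Nonempty
  · rw [mop_active K lam F hη]
    have h1 := h η _ (mem_active.1 hη.choose_spec)
    split_ifs with h0
    · exact h1
    · exact mv_of_lz K _ ENNReal.ofReal_ne_top (ne_top_of_le_ne_top hB (hF η)) h1 h0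
  · exact mop_stable K lam F hη

lemma Hs_eq_Qv (hsub : SubStochastic K) (hnd : NonDegenerate K) (lam : ℝ) (b : V → Bool)
    (η : Conf V) : Hs K lam η b = Qv K (ENNReal.ofReal lam) b η := by
  rw [harm_unique hsub hnd lam ENNReal.one_ne_top (Qv_le_one hsub ENNReal.ofReal_ne_top b)
    (mop_of_lz ENNReal.one_ne_top (Qv_le_one hsub ENNReal.ofReal_ne_top b)
      fun η x hx => Qv_lz K _ b hx) η]
  simp [Qv_embed, embed_inj]

lemma Hs_lz (hsub : SubStochastic K) (hnd : NonDegenerate K) (lam : ℝ) (b : V → Bool)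
    {η : Conf V} {x : V} (hx : (η x).isActive = true) :
    lz K (ENNReal.ofReal lam) x (fun η => Hs K lam η b) η = Hs K lam η b := by
  simp only [Hs_eq_Qv hsub hnd]
  exact Qv_lz K _ b hx

lemma Hs_le_one (hsub : SubStochastic K) (hnd : NonDegenerate K) (lam : ℝ) (b : V → Bool)
    (η : Conf V) : Hs K lam η b ≤ 1 := by
  rw [Hs_eq_Qv hsub hnd]; exact Qv_le_one hsub ENNReal.ofReal_ne_top b η

lemma Hs_embed (hsub : SubStochastic K) (hnd : NonDegenerate K) (lam : ℝ) (b b' : V → Bool) :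
    Hs K lam (embed b) b' = if b = b' then 1 else 0 := by
  rw [Hs_eq_Qv hsub hnd, Qv_embed]; simp [embed_inj]

lemma Hs_sum (hsub : SubStochastic K) (hnd : NonDegenerate K) (lam : ℝ) (η : Conf V) :
    ∑ b, Hs K lam η b = 1 := by
  have := harm_unique hsub hnd lam (F := fun _ => 1) ENNReal.one_ne_top (fun _ => le_rfl)
    (mop_of_lz ENNReal.one_ne_top (fun _ => le_rfl) fun η x _ => by
      simp [lz, wt_sum _ hsub ENNReal.ofReal_ne_top]) η
  simpa using this.symm

/-- stabilise-then-add equals add-then-stabilise -/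
lemma Hs_add (hsub : SubStochastic K) (hnd : NonDegenerate K) (lam : ℝ) (η : Conf V) (x : V)
    (b' : V → Bool) : Hs K lam (addActiveAt η x) b'
      = ∑ b, Hs K lam η b * Hs K lam (addActiveAt (embed b) x) b' := by
  refine harm_unique hsub hnd lam (F := fun η => Hs K lam (addActiveAt η x) b')
    ENNReal.one_ne_top (fun _ => Hs_le_one hsub hnd lam _ _)
    (mop_of_lz ENNReal.one_ne_top (fun _ => Hs_le_one hsub hnd lam _ _) fun η y hy => ?_) η
  rw [← Hs_lz hsub hnd lam b' (active_add hy x)]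
  simp only [lz, act_add hy]

end Term
end ARW

set_option linter.unusedSectionVars false

namespace ARW

section Walk
variable {V : Type} [Fintype V] [DecidableEq V] {K : V → V → ℝ≥0∞}

def listEquiv (V : Type) : Unit ⊕ (V × List V) ≃ List V where
  toFun | Sum.inl _ => [] | Sum.inr p => p.1 :: p.2
  invFun | [] => Sum.inl () | (x :: xs) => Sum.inr (x, xs)
  left_inv := by rintro (_ | ⟨x, xs⟩) <;> rfl
  right_inv := by rintro (_ | ⟨x, xs⟩) <;> rfl

lemma tsum_list (G : List V → ℝ≥0∞) :
    ∑' xs, G xs = G [] + ∑ y, ∑' ys, G (y :: ys) := by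
  rw [← (listEquiv V).tsum_eq]
  have h1 : HasSum ((fun c => G ((listEquiv V) c)) ∘ Sum.inl) (G []) := by
    have := hasSum_fintype ((fun c => G ((listEquiv V) c)) ∘ Sum.inl)
    rw [Fintype.sum_unique] at this; exact this
  have h2 : HasSum ((fun c => G ((listEquiv V) c)) ∘ Sum.inr) (∑ y, ∑' ys, G (y :: ys)) := by
    have h3 := (ENNReal.summable (f := (fun c => G ((listEquiv V) c)) ∘ Sum.inr)).hasSum
    rw [ENNReal.tsum_prod', tsum_fintype] at h3
    exact h3
  exact (HasSum.sum h1 h2).tsum_eq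

lemma tsum_path (x : V) (G : List V → ℝ≥0∞) :
    ∑' xs, pathProb K x xs * G xs = (1 - ∑ y, K x y) * G []
      + ∑ y, K x y * ∑' ys, pathProb K y ys * G (y :: ys) := by
  rw [tsum_list]
  congr 1
  refine Finset.sum_congr rfl fun y _ => ?_
  rw [← ENNReal.tsum_mul_left]
  exact tsum_congr fun ys => by simp only [pathProb]; ring

lemma path_trunc_le (hsub : SubStochastic K) (n : ℕ) (x : V) :
    ∑' xs : List V, pathProb K x xs * (if xs.length < n then 1 else 0) ≤ 1 := by
  induction n generalizing x with
  | zero => simp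
  | succ n ih =>
    rw [tsum_path]
    simp only [List.length_cons, Nat.add_lt_add_iff_right]
    calc _ ≤ (1 - ∑ y, K x y) * 1 + ∑ y, K x y * 1 := by
          gcongr with y
          · simp
          · exact ih y
      _ = 1 := by simp only [mul_one]; exact tsub_add_cancel_of_le (hsub x)

lemma path_le (hsub : SubStochastic K) (x : V) : ∑' xs : List V, pathProb K x xs ≤ 1 := by
  rw [ENNReal.tsum_eq_iSup_sum]
  refine iSup_le fun s => ?_
  refine le_trans ?_ (path_trunc_le hsub (s.sup List.length + 1) x)
  refine le_trans ?_ (ENNReal.sum_le_tsum s)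
  refine Finset.sum_le_sum fun xs hxs => ?_
  rw [if_pos, mul_one]
  exact Nat.lt_succ_of_le (Finset.le_sup (f := List.length) hxs)

/-- real form of the killed-walk recursion -/
lemma toReal_rec (hsub : SubStochastic K) {a : ℝ≥0∞} (ha : a ≤ 1) {f : V → ℝ≥0∞}
    (hf : ∀ y, f y ≤ 1) (x : V) :
    ((1 - ∑ y, K x y) * a + ∑ y, K x y * f y).toReal
      = (1 - ∑ y, (K x y).toReal) * a.toReal + ∑ y, (K x y).toReal * (f y).toReal := by
  have hat : a ≠ ⊤ := ne_top_of_le_ne_top ENNReal.one_ne_top ha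
  have hft : ∀ y, f y ≠ ⊤ := fun y => ne_top_of_le_ne_top ENNReal.one_ne_top (hf y)
  have hKf : ∀ y ∈ Finset.univ, K x y * f y ≠ ⊤ := fun y _ =>
    ENNReal.mul_ne_top (K_ne_top hsub x y) (hft y)
  rw [ENNReal.toReal_add (ENNReal.mul_ne_top (by simp) hat) (ENNReal.sum_ne_top.2 hKf),
    ENNReal.toReal_mul, ENNReal.toReal_sub_of_le (hsub x) ENNReal.one_ne_top,
    ENNReal.toReal_sum hKf, ENNReal.toReal_sum (fun y _ => K_ne_top hsub x y)]
  simp only [ENNReal.toReal_mul, ENNReal.toReal_one]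

lemma path_total (hsub : SubStochastic K) (hnd : NonDegenerate K) (x : V) :
    ∑' xs : List V, pathProb K x xs = 1 := by
  have h : ∀ x, (∑' xs : List V, pathProb K x xs).toReal - 1 = 0 := by
    refine kill_unique hsub hnd _ fun x => Or.inr ?_
    have h1 := tsum_path (K := K) x (fun _ => 1)
    simp only [mul_one] at h1
    have h2 := toReal_rec hsub (le_refl 1) (path_le hsub) x
    simp only [mul_one] at h2
    rw [h1, h2]
    simp only [mul_sub, Finset.sum_sub_distrib, ENNReal.toReal_one, mul_one]
    ring
  rw [← ENNReal.toReal_eq_one_iff]; linarith [h x]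

/-- expectation of a function of the IDLA update along the walk from `x` -/
noncomputable def psiW (K : V → V → ℝ≥0∞) (Φ : Finset V → ℝ≥0∞) (S : Finset V) (x : V) : ℝ≥0∞ :=
  ∑' xs, pathProb K x xs * Φ (idlaUpdate S (x :: xs))

lemma psiW_le (hsub : SubStochastic K) {Φ : Finset V → ℝ≥0∞} (h : ∀ S, Φ S ≤ 1) (S : Finset V)
    (x : V) : psiW K Φ S x ≤ 1 := by
  refine le_trans (ENNReal.tsum_le_tsum fun xs => ?_) (path_le hsub x)
  calc _ ≤ pathProb K x xs * 1 := by gcongr; exact h _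
    _ = _ := mul_one _

lemma psiW_notMem (hsub : SubStochastic K) (hnd : NonDegenerate K) (Φ : Finset V → ℝ≥0∞)
    {S : Finset V} {x : V} (hx : x ∉ S) : psiW K Φ S x = Φ (insert x S) := by
  simp only [psiW, idlaUpdate, if_neg hx]
  rw [ENNReal.tsum_mul_right, path_total hsub hnd, one_mul]

lemma psiW_mem (Φ : Finset V → ℝ≥0∞) {S : Finset V} {x : V} (hx : x ∈ S) :
    psiW K Φ S x = (1 - ∑ y, K x y) * Φ S + ∑ y, K x y * psiW K Φ S y := by
  have : psiW K Φ S x = ∑' xs, pathProb K x xs * Φ (idlaUpdate S xs) := by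
    simp only [psiW]
    refine tsum_congr fun xs => ?_
    rw [idlaUpdate, if_pos hx]
  rw [this, tsum_path]; rfl

lemma walk_psiW (ν : V → ℝ≥0∞) (Φ : Finset V → ℝ≥0∞) (S : Finset V) :
    ∑' w, walkProb K ν w * Φ (idlaUpdate S w) = ∑ x, ν x * psiW K Φ S x := by
  rw [tsum_list]
  simp only [walkProb, zero_mul, zero_add]
  refine Finset.sum_congr rfl fun y _ => ?_
  rw [psiW, ← ENNReal.tsum_mul_left]
  exact tsum_congr fun ys => by ring

lemma walk_total (hsub : SubStochastic K) (hnd : NonDegenerate K) {ν : V → ℝ≥0∞}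
    (hν : IsProbVec ν) : ∑' w, walkProb K ν w = 1 := by
  rw [tsum_list]
  simp only [walkProb, zero_add, ENNReal.tsum_mul_left, path_total hsub hnd, mul_one]
  exact hν

lemma nu_ne_top {ν : V → ℝ≥0∞} (hν : IsProbVec ν) (x : V) : ν x ≠ ⊤ := by
  have h1 : ν x ≤ ∑ y, ν y := Finset.single_le_sum (fun _ _ => zero_le) (Finset.mem_univ x)
  rw [hν] at h1
  exact ne_top_of_le_ne_top ENNReal.one_ne_top h1

noncomputable def om (K : V → V → ℝ≥0∞) (ν : V → ℝ≥0∞) (w : List V) : ℝ := (walkProb K ν w).toReal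

lemma om_nonneg (ν : V → ℝ≥0∞) (w : List V) : 0 ≤ om K ν w := ENNReal.toReal_nonneg

noncomputable def Rop (K : V → V → ℝ≥0∞) (ν : V → ℝ≥0∞) (f : Finset V → ℝ) (S : Finset V) : ℝ :=
  ∑' w, om K ν w * f (idlaUpdate S w)

/-- the unique solution property: harmonic functions along the walk -/
lemma walk_harm (hsub : SubStochastic K) (hnd : NonDegenerate K) {ν : V → ℝ≥0∞}
    (hν : IsProbVec ν) (f : Finset V → ℝ) (hf0 : ∀ S, 0 ≤ f S) (hf1 : ∀ S, f S ≤ 1)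
    (S : Finset V) (φ : V → ℝ) (h1 : ∀ x, x ∉ S → φ x = f (insert x S))
    (h2 : ∀ x ∈ S, φ x = (1 - ∑ y, (K x y).toReal) * f S + ∑ y, (K x y).toReal * φ y) :
    ∑ x, (ν x).toReal * φ x = Rop K ν f S := by
  let Φ : Finset V → ℝ≥0∞ := fun S => ENNReal.ofReal (f S)
  have hΦ : ∀ S, Φ S ≤ 1 := fun S => by simpa [Φ] using hf1 S
  have hv : ∀ x, φ x - (psiW K Φ S x).toReal = 0 := by
    refine kill_unique hsub hnd _ fun x => ?_
    by_cases hx : x ∈ S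
    · right
      rw [h2 x hx, psiW_mem Φ hx, toReal_rec hsub (hΦ S) (psiW_le hsub hΦ S)]
      simp only [mul_sub, Finset.sum_sub_distrib, Φ, ENNReal.toReal_ofReal (hf0 _)]
      ring
    · left
      rw [h1 x hx, psiW_notMem hsub hnd Φ hx]
      simp [Φ, ENNReal.toReal_ofReal (hf0 _)]
  have h3 := congrArg ENNReal.toReal (walk_psiW (K := K) ν Φ S)
  have hne : ∀ w, walkProb K ν w * Φ (idlaUpdate S w) ≠ ⊤ := by
    intro w
    refine ne_top_of_le_ne_top ENNReal.one_ne_top ?_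
    rw [← walk_total hsub hnd hν]
    refine le_trans ?_ (ENNReal.le_tsum w)
    calc _ ≤ walkProb K ν w * 1 := by gcongr; exact hΦ _
      _ = _ := mul_one _
  rw [ENNReal.tsum_toReal_eq hne, ENNReal.toReal_sum (fun x _ => ENNReal.mul_ne_top
    (nu_ne_top hν x) (ne_top_of_le_ne_top ENNReal.one_ne_top (psiW_le hsub hΦ S x)))] at h3
  simp only [ENNReal.toReal_mul, Φ, ENNReal.toReal_ofReal (hf0 _)] at h3
  unfold Rop om
  rw [h3]
  refine Finset.sum_congr rfl fun x _ => ?_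
  rw [show φ x = (psiW K Φ S x).toReal by linarith [hv x]]

/-! ### algebra of `Rop` -/

structure WalkLaw (K : V → V → ℝ≥0∞) (ν : V → ℝ≥0∞) : Prop where
  has : HasSum (om K ν) 1

lemma walkLaw (hsub : SubStochastic K) (hnd : NonDegenerate K) {ν : V → ℝ≥0∞}
    (hν : IsProbVec ν) : WalkLaw K ν := by
  have h := walk_total hsub hnd hν
  have hne : ∑' w, walkProb K ν w ≠ ⊤ := by rw [h]; exact ENNReal.one_ne_top
  refine ⟨?_⟩
  have h1 : Summable (om K ν) := ENNReal.summable_toReal hne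
  have h2 : ∑' w, om K ν w = 1 := by
    unfold om
    rw [← ENNReal.tsum_toReal_eq (ENNReal.ne_top_of_tsum_ne_top hne), h, ENNReal.toReal_one]
  rw [← h2]; exact h1.hasSum

variable {ν : V → ℝ≥0∞}

lemma om_summable (W : WalkLaw K ν) (G : List V → ℝ) (B : ℝ) (hB : ∀ w, |G w| ≤ B) :
    Summable fun w => om K ν w * G w := by
  refine Summable.of_norm_bounded (W.has.summable.mul_right B) fun w => ?_
  rw [Real.norm_eq_abs, abs_mul, abs_of_nonneg (om_nonneg ν w)]
  exact mul_le_mul_of_nonneg_left (hB w) (om_nonneg ν w)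

lemma om_summable' (W : WalkLaw K ν) (f : Finset V → ℝ) (S : Finset V) :
    Summable fun w => om K ν w * f (idlaUpdate S w) := by
  refine om_summable W _ (∑ S, |f S|) fun w => ?_
  exact Finset.single_le_sum (f := fun S => |f S|) (fun _ _ => abs_nonneg _) (Finset.mem_univ _)

lemma Rop_add (W : WalkLaw K ν) (f g : Finset V → ℝ) (S : Finset V) :
    Rop K ν (fun S => f S + g S) S = Rop K ν f S + Rop K ν g S := by
  unfold Rop
  rw [← (om_summable' W f S).tsum_add (om_summable' W g S)]
  exact tsum_congr fun w => by ring

lemma Rop_smul (c : ℝ) (f : Finset V → ℝ) (S : Finset V) :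
    Rop K ν (fun S => c * f S) S = c * Rop K ν f S := by
  unfold Rop
  rw [← tsum_mul_left]
  exact tsum_congr fun w => by ring

lemma Rop_const (W : WalkLaw K ν) (c : ℝ) (S : Finset V) : Rop K ν (fun _ => c) S = c := by
  unfold Rop
  rw [tsum_mul_right, W.has.tsum_eq, one_mul]

/-- comparison along the coupling -/
lemma Rop_le (W : WalkLaw K ν) (f g : Finset V → ℝ) (S S' : Finset V) (c : ℝ)
    (h : ∀ w, f (idlaUpdate S w) ≤ g (idlaUpdate S' w) + c) : Rop K ν f S ≤ Rop K ν g S' + c := by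
  rw [← Rop_const W c S', ← Rop_add W]
  unfold Rop
  refine Summable.tsum_le_tsum (fun w => ?_) (om_summable' W f S)
    (om_summable' W (fun S => g S + c) S')
  exact mul_le_mul_of_nonneg_left (h w) (om_nonneg ν w)

lemma Rop_mono (W : WalkLaw K ν) {f g : Finset V → ℝ} (h : ∀ S, f S ≤ g S) (S : Finset V) :
    Rop K ν f S ≤ Rop K ν g S := by
  have := Rop_le W f g S S 0 (fun w => by simpa using h _)
  simpa using this

end Walk
end ARW

set_option linter.unusedSectionVars false
set_option linter.unusedVariables false

namespace ARW
section P4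
variable {V : Type} [Fintype V] [DecidableEq V] {K : V → V → ℝ≥0∞} {ν : V → ℝ≥0∞}

noncomputable def hr (K : V → V → ℝ≥0∞) (lam : ℝ) (η : Conf V) (b : V → Bool) : ℝ :=
  (Hs K lam η b).toReal

lemma hr_nonneg (lam : ℝ) (η : Conf V) (b : V → Bool) : 0 ≤ hr K lam η b := ENNReal.toReal_nonneg

lemma Hs_ne_top (hsub : SubStochastic K) (hnd : NonDegenerate K) (lam : ℝ) (b : V → Bool)
    (η : Conf V) : Hs K lam η b ≠ ⊤ :=
  ne_top_of_le_ne_top ENNReal.one_ne_top (Hs_le_one hsub hnd lam b η)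

lemma hr_sum (hsub : SubStochastic K) (hnd : NonDegenerate K) (lam : ℝ) (η : Conf V) :
    ∑ b, hr K lam η b = 1 := by
  unfold hr
  rw [← ENNReal.toReal_sum (fun b _ => Hs_ne_top hsub hnd lam b η), Hs_sum hsub hnd]; simp

lemma hr_le_one (hsub : SubStochastic K) (hnd : NonDegenerate K) (lam : ℝ) (η : Conf V)
    (b : V → Bool) : hr K lam η b ≤ 1 := by
  rw [← hr_sum hsub hnd lam η]
  exact Finset.single_le_sum (f := fun b => hr K lam η b) (fun _ _ => hr_nonneg _ _ _)
    (Finset.mem_univ b)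

lemma hr_embed (hsub : SubStochastic K) (hnd : NonDegenerate K) (lam : ℝ) (b b' : V → Bool) :
    hr K lam (embed b) b' = if b = b' then 1 else 0 := by
  unfold hr; rw [Hs_embed hsub hnd]; split <;> simp

lemma hr_mv (hsub : SubStochastic K) (hnd : NonDegenerate K) (lam : ℝ) (b : V → Bool)
    {η : Conf V} {x : V} {n : ℕ} (hx : η x = Site.active (n+1)) :
    hr K lam η b = (1 - ∑ y, (K x y).toReal) * hr K lam (rem η x) b
      + ∑ y, (K x y).toReal * hr K lam (addActiveAt (rem η x) y) b := by
  have h1 := Hs_lz hsub hnd lam b (η := η) (x := x) (by rw [hx]; rfl)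
  have h2 := mv_of_lz K _ ENNReal.ofReal_ne_top (Hs_ne_top hsub hnd lam b η) h1 (by rw [hx]; simp)
  unfold hr
  rw [← h2, mv, add_comm]
  exact toReal_rec hsub (Hs_le_one hsub hnd lam b _) (fun y => Hs_le_one hsub hnd lam b _) x

lemma hr_lz (hsub : SubStochastic K) (hnd : NonDegenerate K) {lam : ℝ} (hlam : 0 < lam) (b : V → Bool)
    {η : Conf V} {x : V} (hx : (η x).isActive = true) :
    (lam + 1) * hr K lam η b = lam * hr K lam (slp η x) b
      + ((1 - ∑ y, (K x y).toReal) * hr K lam (rem η x) b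
      + ∑ y, (K x y).toReal * hr K lam (addActiveAt (rem η x) y) b) := by
  have h1 := Hs_lz hsub hnd lam b (η := η) (x := x) hx
  rw [lz_eq, ediv_eq_iff (by simp) (by simp)] at h1
  have h3 := toReal_rec hsub (Hs_le_one hsub hnd lam b (rem η x))
    (fun y => Hs_le_one hsub hnd lam b (addActiveAt (rem η x) y)) x
  have h4 : mv K x (fun η => Hs K lam η b) η ≠ ⊤ := by
    unfold mv
    refine ENNReal.add_ne_top.2 ⟨ENNReal.sum_ne_top.2 fun y _ =>
      ENNReal.mul_ne_top (K_ne_top hsub x y) (Hs_ne_top hsub hnd lam b _), 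
      ENNReal.mul_ne_top (by simp) (Hs_ne_top hsub hnd lam b _)⟩
  have h2 := congrArg ENNReal.toReal h1
  rw [ENNReal.toReal_add (ENNReal.mul_ne_top ENNReal.ofReal_ne_top (Hs_ne_top hsub hnd lam b _)) h4,
    ENNReal.toReal_mul, ENNReal.toReal_mul, ENNReal.toReal_add ENNReal.ofReal_ne_top (by simp),
    ENNReal.toReal_ofReal hlam.le, mv, add_comm (∑ y, _), h3] at h2
  unfold hr
  rw [h2]; simp; ring

lemma P_eq (hsub : SubStochastic K) (hnd : NonDegenerate K) (lam : ℝ) (hν : IsProbVec ν)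
    (b b' : V → Bool) : arwMatrix K lam ν b b'
      = ∑ x, (ν x).toReal * hr K lam (addActiveAt (embed b) x) b' := by
  have e : arwMatrix K lam ν b b' = (∑ x, ν x * Hs K lam (addActiveAt (embed b) x) b').toReal := rfl
  rw [e, ENNReal.toReal_sum (fun x _ => ENNReal.mul_ne_top (nu_ne_top hν x)
    (Hs_ne_top hsub hnd lam b' _))]
  refine Finset.sum_congr rfl fun x _ => ?_
  rw [ENNReal.toReal_mul]; rfl

lemma nu_sum (hν : IsProbVec ν) : ∑ x, (ν x).toReal = 1 := by
  rw [← ENNReal.toReal_sum (fun x _ => nu_ne_top hν x), hν]; simp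

lemma P_nonneg (lam : ℝ) (b b' : V → Bool) : 0 ≤ arwMatrix K lam ν b b' := ENNReal.toReal_nonneg

lemma P_sum (hsub : SubStochastic K) (hnd : NonDegenerate K) (lam : ℝ) (hν : IsProbVec ν)
    (b : V → Bool) : ∑ b', arwMatrix K lam ν b b' = 1 := by
  simp only [P_eq hsub hnd lam hν]
  rw [Finset.sum_comm]
  simp only [← Finset.mul_sum, hr_sum hsub hnd, mul_one, nu_sum hν]

lemma Pt_nonneg (lam : ℝ) (t : ℕ) (b b' : V → Bool) : 0 ≤ (arwMatrix K lam ν ^ t) b b' := by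
  induction t generalizing b with
  | zero => rw [pow_zero, Matrix.one_apply]; split <;> norm_num
  | succ t ih =>
    rw [pow_succ', Matrix.mul_apply]
    exact Finset.sum_nonneg fun c _ => mul_nonneg (P_nonneg _ _ _) (ih c)

lemma Pt_sum (hsub : SubStochastic K) (hnd : NonDegenerate K) (lam : ℝ) (hν : IsProbVec ν) (t : ℕ)
    (b : V → Bool) : ∑ b', (arwMatrix K lam ν ^ t) b b' = 1 := by
  induction t generalizing b with
  | zero => simp [Matrix.one_apply]
  | succ t ih =>
    simp only [pow_succ', Matrix.mul_apply]
    rw [Finset.sum_comm]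
    simp only [← Finset.mul_sum, ih, mul_one, P_sum hsub hnd lam hν]

lemma Pt_le_one (hsub : SubStochastic K) (hnd : NonDegenerate K) (lam : ℝ) (hν : IsProbVec ν) (t : ℕ)
    (b b' : V → Bool) : (arwMatrix K lam ν ^ t) b b' ≤ 1 := by
  rw [← Pt_sum hsub hnd lam hν t b]
  exact Finset.single_le_sum (f := fun b' => (arwMatrix K lam ν ^ t) b b')
    (fun _ _ => Pt_nonneg _ _ _ _) (Finset.mem_univ b')

lemma hr_add (hsub : SubStochastic K) (hnd : NonDegenerate K) (lam : ℝ) (η : Conf V) (x : V)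
    (b' : V → Bool) : hr K lam (addActiveAt η x) b'
      = ∑ b, hr K lam η b * hr K lam (addActiveAt (embed b) x) b' := by
  unfold hr
  rw [Hs_add hsub hnd, ENNReal.toReal_sum (fun b _ => ENNReal.mul_ne_top (Hs_ne_top hsub hnd lam b _)
    (Hs_ne_top hsub hnd lam b' _))]
  simp only [ENNReal.toReal_mul]

/-- expected `P^t(·,ξ)` after stabilising `c`. -/
noncomputable def Ph (K : V → V → ℝ≥0∞) (lam : ℝ) (ν : V → ℝ≥0∞) (ξ : V → Bool) (t : ℕ) (c : Conf V) : ℝ :=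
  ∑ b, hr K lam c b * (arwMatrix K lam ν ^ t) b ξ

lemma Ph_zero (lam : ℝ) (ξ : V → Bool) (c : Conf V) : Ph K lam ν ξ 0 c = hr K lam c ξ := by
  simp [Ph, Matrix.one_apply]

lemma Ph_nonneg (lam : ℝ) (ξ : V → Bool) (t : ℕ) (c : Conf V) : 0 ≤ Ph K lam ν ξ t c :=
  Finset.sum_nonneg fun b _ => mul_nonneg (hr_nonneg _ _ _) (Pt_nonneg _ _ _ _)

lemma Ph_le_one (hsub : SubStochastic K) (hnd : NonDegenerate K) (lam : ℝ) (hν : IsProbVec ν)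
    (ξ : V → Bool) (t : ℕ) (c : Conf V) : Ph K lam ν ξ t c ≤ 1 := by
  rw [← hr_sum hsub hnd lam c]
  refine Finset.sum_le_sum fun b _ => ?_
  exact mul_le_of_le_one_right (hr_nonneg _ _ _) (Pt_le_one hsub hnd lam hν t b ξ)

lemma Ph_embed (hsub : SubStochastic K) (hnd : NonDegenerate K) (lam : ℝ) 
    (ξ : V → Bool) (t : ℕ) (b : V → Bool) : Ph K lam ν ξ t (embed b) = (arwMatrix K lam ν ^ t) b ξ := by
  simp [Ph, hr_embed hsub hnd]

lemma Ph_succ (hsub : SubStochastic K) (hnd : NonDegenerate K) (lam : ℝ) (hν : IsProbVec ν)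
    (ξ : V → Bool) (t : ℕ) (c : Conf V) :
    Ph K lam ν ξ (t+1) c = ∑ x, (ν x).toReal * Ph K lam ν ξ t (addActiveAt c x) := by
  simp only [Ph, pow_succ', Matrix.mul_apply, P_eq hsub hnd lam hν]
  simp only [hr_add hsub hnd lam c, Finset.mul_sum, Finset.sum_mul]
  have e : ∀ f : (V → Bool) → (V → Bool) → V → ℝ, ∑ b, ∑ b', ∑ x, f b b' x = ∑ x, ∑ b', ∑ b, f b b' x := by
    intro f
    rw [Finset.sum_comm]
    simp_rw [Finset.sum_comm (s := Finset.univ (α := V → Bool)) (t := Finset.univ (α := V))]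
  rw [e]
  refine Finset.sum_congr rfl fun x _ => Finset.sum_congr rfl fun b' _ => Finset.sum_congr rfl fun b _ => ?_
  ring

lemma Ph_mv (hsub : SubStochastic K) (hnd : NonDegenerate K) (lam : ℝ)
    (ξ : V → Bool) (t : ℕ) {η : Conf V} {x : V} {n : ℕ} (hx : η x = Site.active (n+1)) :
    Ph K lam ν ξ t η = (1 - ∑ y, (K x y).toReal) * Ph K lam ν ξ t (rem η x)
      + ∑ y, (K x y).toReal * Ph K lam ν ξ t (addActiveAt (rem η x) y) := by
  simp only [Ph, Finset.mul_sum]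
  rw [Finset.sum_comm (s := Finset.univ (α := V)), ← Finset.sum_add_distrib]
  refine Finset.sum_congr rfl fun b _ => ?_
  rw [hr_mv hsub hnd lam b hx, add_mul, Finset.sum_mul]
  congr 1
  · ring
  · exact Finset.sum_congr rfl fun y _ => by ring

def cS (b : V → Bool) (S : Finset V) : Conf V :=
  fun z => if z ∈ S then Site.active (if b z then 1 else 0) else embed b z

lemma cS_empty (b : V → Bool) : cS b ∅ = embed b := by funext z; simp [cS]

lemma cS_insert (b : V → Bool) {S : Finset V} {x : V} (hx : x ∉ S) :
    addActiveAt (cS b S) x = cS b (insert x S) := by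
  funext z
  unfold addActiveAt
  by_cases h : z = x
  · subst h
    rw [Function.update_self]
    simp only [cS, hx, if_false, Finset.mem_insert_self, if_true, embed]
    cases b z <;> rfl
  · rw [Function.update_of_ne h]
    simp [cS, h]

lemma add_eq_active {c : Conf V} {x : V} (hx : (c x).isActive = true) :
    ∃ n, (addActiveAt c x) x = Site.active (n+1) ∧ rem (addActiveAt c x) x = c := by
  unfold addActiveAt rem
  rw [Function.update_self]
  rcases hs : c x with _ | _ | n
  · rw [hs] at hx; cases hx
  · rw [hs] at hx; cases hx
  · refine ⟨n, rfl, ?_⟩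
    rw [Function.update_idem]
    simp only [Site.addActive, Site.removeOne, ← hs, Function.update_eq_self]

lemma Ph_R (hsub : SubStochastic K) (hnd : NonDegenerate K) (lam : ℝ) (hν : IsProbVec ν)
    (ξ b : V → Bool) (t : ℕ) (S : Finset V) :
    Ph K lam ν ξ (t+1) (cS b S) = Rop K ν (fun S => Ph K lam ν ξ t (cS b S)) S := by
  rw [Ph_succ hsub hnd lam hν]
  refine walk_harm hsub hnd hν _ (fun _ => Ph_nonneg _ _ _ _)
    (fun _ => Ph_le_one hsub hnd lam hν _ _ _) S (fun x => Ph K lam ν ξ t (addActiveAt (cS b S) x)) ?_ ?_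
  · intro x hx; simp only [cS_insert b hx]
  · intro x hx
    obtain ⟨n, h1, h2⟩ := add_eq_active (c := cS b S) (x := x) (by simp [cS, hx, Site.isActive])
    have := Ph_mv (ν := ν) hsub hnd lam ξ t h1
    rw [h2] at this; exact this

lemma Pt_rep (hsub : SubStochastic K) (hnd : NonDegenerate K) (lam : ℝ) (hν : IsProbVec ν)
    (ξ b : V → Bool) (t : ℕ) (S : Finset V) :
    Ph K lam ν ξ t (cS b S) = (Rop K ν)^[t] (fun S => hr K lam (cS b S) ξ) S := by
  induction t generalizing S with
  | zero => simp [Ph_zero]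
  | succ t ih =>
    rw [Ph_R hsub hnd lam hν, Function.iterate_succ_apply']
    congr 1; funext S; exact ih S

lemma hr_add_full (hsub : SubStochastic K) (hnd : NonDegenerate K) (lam : ℝ) (ξ : V → Bool)
    (c : Conf V) (hc : ∀ x, (c x).isActive = true) (x : V) :
    hr K lam (addActiveAt c x) ξ = hr K lam c ξ := by
  have := kill_unique hsub hnd (fun x => hr K lam (addActiveAt c x) ξ - hr K lam c ξ) ?_ x
  · linarith
  intro x; right
  obtain ⟨n, h1, h2⟩ := add_eq_active (hc x)
  have := hr_mv hsub hnd lam ξ h1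
  rw [h2] at this
  simp only [mul_sub, Finset.sum_sub_distrib, ← Finset.sum_mul]
  linarith

noncomputable def mu (K : V → V → ℝ≥0∞) (lam : ℝ) (ξ : V → Bool) : ℝ :=
  hr K lam (fun _ => Site.active 0) ξ

lemma hr_univ (hsub : SubStochastic K) (hnd : NonDegenerate K) (lam : ℝ) (ξ b : V → Bool) :
    hr K lam (cS b Finset.univ) ξ = mu K lam ξ := by
  have h : ∀ B : Finset V, hr K lam (fun z => Site.active (if z ∈ B then 1 else 0)) ξ = mu K lam ξ := by
    intro B
    induction B using Finset.induction_on with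
    | empty => simp [mu]
    | insert x B hx ih =>
      rw [← ih]; refine Eq.trans ?_ (hr_add_full hsub hnd lam ξ _ (fun _ => rfl) x)
      congr 1
      funext z
      unfold addActiveAt
      by_cases h : z = x
      · subst h; rw [Function.update_self]; simp [hx, Site.addActive]
      · rw [Function.update_of_ne h]; simp [h]
  rw [← h (Finset.univ.filter fun z => b z = true)]
  congr 1
  funext z; simp [cS]

def ind (S : Finset V) : ℝ := if S = Finset.univ then 0 else 1

noncomputable def tau (K : V → V → ℝ≥0∞) (ν : V → ℝ≥0∞) (t : ℕ) : Finset V → ℝ := (Rop K ν)^[t] ind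

lemma Rit_mono (W : WalkLaw K ν) (t : ℕ) {f g : Finset V → ℝ} (h : ∀ S, f S ≤ g S) (S : Finset V) :
    (Rop K ν)^[t] f S ≤ (Rop K ν)^[t] g S := by
  induction t generalizing S with
  | zero => exact h S
  | succ t ih =>
    rw [Function.iterate_succ_apply', Function.iterate_succ_apply']
    exact Rop_mono W ih S

lemma Rit_aff (W : WalkLaw K ν) (t : ℕ) (c : ℝ) (S : Finset V) :
    (Rop K ν)^[t] (fun S => c + (-c) * ind S) S = (1 - tau K ν t S) * c := by
  have : (Rop K ν)^[t] (fun S => c + (-c) * ind S) = fun S => c + (-c) * tau K ν t S := by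
    induction t with
    | zero => rfl
    | succ t ih =>
      rw [Function.iterate_succ_apply', ih]
      funext S
      rw [Rop_add W (fun _ => c), Rop_const W, Rop_smul, tau, tau, Function.iterate_succ_apply']
  rw [this]; ring

lemma Pt_ge (hsub : SubStochastic K) (hnd : NonDegenerate K) (lam : ℝ) (hν : IsProbVec ν)
    (ξ b : V → Bool) (t : ℕ) :
    (1 - tau K ν t ∅) * mu K lam ξ ≤ (arwMatrix K lam ν ^ t) b ξ := by
  have W := walkLaw hsub hnd hν
  rw [← Ph_embed hsub hnd lam, ← cS_empty, Pt_rep hsub hnd lam hν, ← Rit_aff W]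
  refine Rit_mono W t (fun S => ?_) _
  by_cases h : S = Finset.univ
  · rw [h, hr_univ hsub hnd]; simp [ind]
  · simp only [ind, if_neg h]; linarith [hr_nonneg (K := K) lam (cS b S) ξ]

/-- particle count -/
def Site.cnt : Site → ℕ
  | .empty => 0
  | .sleeping => 1
  | .active n => n + 1

def cnt (η : Conf V) : ℕ := ∑ x, (η x).cnt

lemma cnt_update (η : Conf V) (x : V) (s : Site) :
    cnt (Function.update η x s) + (η x).cnt = cnt η + s.cnt := by
  unfold cnt
  rw [← Finset.add_sum_erase _ _ (Finset.mem_univ x), ← Finset.add_sum_erase Finset.univ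
    (fun x => (η x).cnt) (Finset.mem_univ x), Function.update_self]
  have : ∑ y ∈ Finset.univ.erase x, (Function.update η x s y).cnt = ∑ y ∈ Finset.univ.erase x, (η y).cnt :=
    Finset.sum_congr rfl fun y hy => by rw [Function.update_of_ne (Finset.ne_of_mem_erase hy)]
  rw [this]; ring

lemma cnt_add (η : Conf V) (y : V) : cnt (addActiveAt η y) = cnt η + 1 := by
  have := cnt_update η y (η y).addActive
  unfold addActiveAt
  rcases hs : η y with _ | _ | n <;> simp only [hs, Site.addActive, Site.cnt] at this ⊢ <;> omega

lemma cnt_rem {η : Conf V} {x : V} (hx : (η x).isActive = true) : cnt (rem η x) + 1 = cnt η := by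
  have := cnt_update η x (η x).removeOne
  unfold rem
  rcases hs : η x with _ | _ | n
  · rw [hs] at hx; cases hx
  · rw [hs] at hx; cases hx
  · rcases n with _ | n <;> simp only [hs, Site.removeOne, Site.cnt] at this ⊢ <;> omega

lemma cnt_slp (η : Conf V) (x : V) : cnt (slp η x) = cnt η := by
  have := cnt_update η x (η x).sleepOne
  unfold slp
  rcases hs : η x with _ | _ | n
  · simp only [hs, Site.sleepOne, Site.cnt] at this ⊢; omega
  · simp only [hs, Site.sleepOne, Site.cnt] at this ⊢; omega
  · rcases n with _ | n <;> simp only [hs, Site.sleepOne, Site.cnt] at this ⊢ <;> omega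

lemma kp_cnt (lam : ℝ) (b : V → Bool) (t : ℕ) (η : Conf V) (h : cnt η < cnt (embed b)) :
    (mop K lam)^[t] (fun η => if embed b = η then 1 else 0) η = 0 := by
  induction t generalizing η with
  | zero =>
    simp only [Function.iterate_zero, id]
    rw [if_neg]; rintro rfl; exact lt_irrefl _ h
  | succ t ih =>
    rw [Function.iterate_succ_apply']
    by_cases hA : (activeSites η).Nonempty
    · have hx := mem_active.1 hA.choose_spec
      have hmv : mv K hA.choose ((mop K lam)^[t] (fun η => if embed b = η then 1 else 0)) η = 0 := by
        have h1 := cnt_rem hx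
        unfold mv
        rw [ih _ (by omega), mul_zero, add_zero]
        refine Finset.sum_eq_zero fun y _ => ?_
        rw [ih _ (by rw [cnt_add]; omega), mul_zero]
      rw [mop_active K lam _ hA]
      split
      · rw [lz_eq, hmv, ih _ (by rw [cnt_slp]; exact h)]; simp
      · exact hmv
    · rw [mop_stable K lam _ hA]; exact ih η h

lemma hr_cnt (lam : ℝ) (b : V → Bool) (η : Conf V) (h : cnt η < cnt (embed b)) :
    hr K lam η b = 0 := by
  unfold hr Hs
  have : ∀ t, kernelPow (toppleKernel K lam) t η (embed b) = 0 := fun t => by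
    have := congrFun (kp_eq K lam b t) η
    rw [kp_cnt lam b t η h] at this; exact this
  simp [this]

lemma Pt_full (hsub : SubStochastic K) (hnd : NonDegenerate K) (lam : ℝ) (hν : IsProbVec ν) (t : ℕ) :
    (arwMatrix K lam ν ^ t) (fun _ => false) (fun _ => true) = (1 - tau K ν t ∅) * mu K lam (fun _ => true) := by
  have W := walkLaw hsub hnd hν
  rw [← Ph_embed hsub hnd lam, ← cS_empty, Pt_rep hsub hnd lam hν, ← Rit_aff W]
  refine congrFun (congrArg _ ?_) _
  funext S
  by_cases h : S = Finset.univ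
  · rw [h, hr_univ hsub hnd]; simp [ind]
  · simp only [ind, if_neg h]
    rw [hr_cnt]
    · ring
    · have h1 : cnt (cS (fun _ : V => false) S) = S.card := by
        unfold cnt cS
        have : ∀ x, (if x ∈ S then Site.active (if false = true then 1 else 0)
            else embed (fun _ : V => false) x).cnt = if x ∈ S then 1 else 0 := by
          intro x; split <;> simp [Site.cnt, embed]
        simp only [this]; simp
      have h2 : cnt (embed (fun _ : V => true)) = Fintype.card V := by
        simp [cnt, embed, Site.cnt]
      rw [h1, h2]
      exact (Finset.card_lt_iff_ne_univ S).2 h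

/-- configuration with single active particles on `A` -/
def cA (A : Finset V) : Conf V := fun z => if z ∈ A then Site.active 0 else Site.empty

def cAB (A B : Finset V) : Conf V :=
  fun z => if z ∈ A then Site.active 0 else if z ∈ B then Site.sleeping else Site.empty

lemma hr_slp_pos (hsub : SubStochastic K) (hnd : NonDegenerate K) {lam : ℝ} (hlam : 0 < lam)
    (ξ : V → Bool) {η : Conf V} {x : V} (hx : (η x).isActive = true) (h : 0 < hr K lam (slp η x) ξ) :
    0 < hr K lam η ξ := by
  have h1 := hr_lz hsub hnd hlam ξ hx
  have h2 := k_sum_le hsub x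
  have h3 : 0 ≤ ∑ y, (K x y).toReal * hr K lam (addActiveAt (rem η x) y) ξ :=
    Finset.sum_nonneg fun y _ => mul_nonneg ENNReal.toReal_nonneg (hr_nonneg _ _ _)
  have h4 : 0 ≤ (1 - ∑ y, (K x y).toReal) * hr K lam (rem η x) ξ :=
    mul_nonneg (by linarith) (hr_nonneg _ _ _)
  have h5 := mul_pos hlam h
  by_contra h6
  have : (lam + 1) * hr K lam η ξ ≤ 0 := mul_nonpos_of_nonneg_of_nonpos (by linarith) (not_lt.1 h6)
  linarith

lemma hr_sleep_all (hsub : SubStochastic K) (hnd : NonDegenerate K) {lam : ℝ} (hlam : 0 < lam)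
    (ξ : V → Bool) (A : Finset V) (hA : A ⊆ Finset.univ.filter fun z => ξ z = true) :
    0 < hr K lam (cAB A (Finset.univ.filter fun z => ξ z = true)) ξ := by
  induction A using Finset.induction_on with
  | empty =>
    have : cAB ∅ (Finset.univ.filter fun z => ξ z = true) = embed ξ := by
      funext z; simp [cAB, embed]
    rw [this, hr_embed hsub hnd]; simp
  | insert x A hx ih =>
    refine hr_slp_pos hsub hnd hlam ξ (x := x) (by simp [cAB, Site.isActive]) ?_
    have e : slp (cAB (insert x A) (Finset.univ.filter fun z => ξ z = true)) x
        = cAB A (Finset.univ.filter fun z => ξ z = true) := by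
      funext z
      unfold slp
      by_cases h : z = x
      · subst h
        have h2 := hA (Finset.mem_insert_self z A)
        rw [Function.update_self]
        simp only [Finset.mem_filter, Finset.mem_univ, true_and] at h2
        simp [cAB, hx, h2, Site.sleepOne]
      · rw [Function.update_of_ne h]; simp [cAB, h]
    rw [e]
    exact ih (fun z hz => hA (Finset.mem_insert_of_mem hz))

/-- positivity propagation -/
lemma hr_pos_add (hsub : SubStochastic K) (hnd : NonDegenerate K) {lam : ℝ} (hlam : 0 < lam)
    (ξ : V → Bool) (c : Conf V) (hc : ∀ x, (c x) ≠ Site.sleeping) (h0 : 0 < hr K lam c ξ) (x : V) :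
    0 < hr K lam (addActiveAt c x) ξ := by
  by_contra hx
  have hx0 : hr K lam (addActiveAt c x) ξ = 0 := le_antisymm (not_lt.1 hx) (hr_nonneg _ _ _)
  refine no_stoch hsub hnd (Finset.univ.filter fun x => hr K lam (addActiveAt c x) ξ = 0)
    ⟨x, by simp [hx0]⟩ ?_
  intro z hz
  simp only [Finset.mem_filter, Finset.mem_univ, true_and] at hz
  have hact : ((addActiveAt c z) z).isActive = true := by
    unfold addActiveAt; rw [Function.update_self]
    rcases c z with _ | _ | n <;> rfl
  have hrem : rem (addActiveAt c z) z = c := by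
    rcases hs : c z with _ | _ | n
    · unfold rem addActiveAt
      rw [Function.update_self, Function.update_idem, hs]
      simp only [Site.addActive, Site.removeOne, ← hs, Function.update_eq_self]
    · exact absurd hs (hc z)
    · obtain ⟨_, _, h⟩ := add_eq_active (c := c) (x := z) (by rw [hs]; rfl)
      exact h
  have h1 := hr_lz hsub hnd hlam ξ hact
  rw [hz, hrem, mul_zero] at h1
  have h2 := k_sum_le hsub z
  have hn : ∀ y ∈ Finset.univ, 0 ≤ (K z y).toReal * hr K lam (addActiveAt c y) ξ :=
    fun y _ => mul_nonneg ENNReal.toReal_nonneg (hr_nonneg _ _ _)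
  have h3 := Finset.sum_nonneg hn
  have h4 : 0 ≤ (1 - ∑ y, (K z y).toReal) * hr K lam c ξ := mul_nonneg (by linarith) h0.le
  have h5 : 0 ≤ lam * hr K lam (slp (addActiveAt c z) z) ξ := mul_nonneg hlam.le (hr_nonneg _ _ _)
  have h6 : (1 - ∑ y, (K z y).toReal) * hr K lam c ξ = 0 := by linarith
  have h7 : ∑ y, (K z y).toReal * hr K lam (addActiveAt c y) ξ = 0 := by linarith
  have h8 : ∑ y, (K z y).toReal = 1 := by
    rcases mul_eq_zero.1 h6 with h | h <;> linarith
  rw [Finset.sum_eq_zero_iff_of_nonneg hn] at h7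
  rw [← h8]
  refine Finset.sum_subset (Finset.filter_subset _ _) fun y _ hy => ?_
  rcases mul_eq_zero.1 (h7 y (Finset.mem_univ y)) with h | h
  · exact h
  · simp [h] at hy

lemma mu_pos (hsub : SubStochastic K) (hnd : NonDegenerate K) {lam : ℝ} (hlam : 0 < lam)
    (ξ : V → Bool) : 0 < mu K lam ξ := by
  have h : ∀ A : Finset V, (∀ z ∈ A, ξ z = false) →
      0 < hr K lam (cA (A ∪ Finset.univ.filter fun z => ξ z = true)) ξ := by
    intro A
    induction A using Finset.induction_on with
    | empty =>
      intro _
      have := hr_sleep_all hsub hnd hlam ξ _ (Finset.Subset.refl _)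
      convert this using 2
      funext z; simp only [cA, cAB]; cases hz : ξ z <;> simp [hz]
    | insert x A hx ih =>
      intro hA
      have h2 := hr_pos_add hsub hnd hlam ξ _ (fun z => by unfold cA; split <;> simp)
        (ih fun z hz => hA z (Finset.mem_insert_of_mem hz)) x
      convert h2 using 2
      have h3 := hA x (Finset.mem_insert_self _ _)
      funext z
      unfold addActiveAt
      by_cases h : z = x
      · subst h; rw [Function.update_self]; simp [cA, hx, h3, Site.addActive]
      · rw [Function.update_of_ne h]; simp [cA, h]
  have := h (Finset.univ.filter fun z => ξ z = false) (by simp)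
  unfold mu
  convert this using 2
  funext z
  cases hz : ξ z <;> simp [cA, hz]

lemma mu_sum (hsub : SubStochastic K) (hnd : NonDegenerate K) (lam : ℝ) : ∑ ξ, mu K lam ξ = 1 :=
  hr_sum hsub hnd lam _

end P4
end ARW

set_option linter.unusedSectionVars false
set_option linter.unusedVariables false

namespace ARW
section P5
variable {V : Type} [Fintype V] [DecidableEq V] {K : V → V → ℝ≥0∞} {ν : V → ℝ≥0∞}

lemma idla_one (S : Finset V) (w : List V) :
    idlaUpdate S w = S ∨ ∃ z, idlaUpdate S w = insert z S := by
  induction w with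
  | nil => left; rfl
  | cons x xs ih =>
    simp only [idlaUpdate]
    by_cases h : x ∈ S
    · simpa [h] using ih
    · right; exact ⟨x, by simp [h]⟩

lemma idla_univ (w : List V) : idlaUpdate Finset.univ w = (Finset.univ : Finset V) := by
  rcases idla_one Finset.univ w with h | ⟨z, h⟩
  · exact h
  · rw [h]; simp

lemma idla_insert (S : Finset V) (z : V) (w : List V) :
    idlaUpdate (insert z S) w = idlaUpdate S w ∨
      ∃ z', idlaUpdate (insert z S) w = insert z' (idlaUpdate S w) := by
  induction w with
  | nil => right; exact ⟨z, rfl⟩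
  | cons x xs ih =>
    simp only [idlaUpdate]
    by_cases h : x ∈ S
    · simpa [h] using ih
    · by_cases hz : x = z
      · subst hz
        simp only [Finset.mem_insert_self, if_true, h, if_false]
        exact idla_one _ _
      · simp only [Finset.mem_insert, hz, h, or_self, if_false]
        right; exact ⟨z, Finset.insert_comm _ _ _⟩

lemma idla_erase (z : V) (w : List V) :
    idlaUpdate (Finset.univ.erase z) w = if z ∈ w then Finset.univ else Finset.univ.erase z := by
  induction w with
  | nil => simp [idlaUpdate]
  | cons x xs ih =>
    simp only [idlaUpdate]
    by_cases hz : x = z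
    · subst hz; simp
    · simp [hz, ih, Ne.symm hz]

noncomputable def pz (K : V → V → ℝ≥0∞) (ν : V → ℝ≥0∞) (z : V) : ℝ := (hitProb K ν z).toReal

lemma pz_eq (W : WalkLaw K ν) (hw : ∑' w, walkProb K ν w = 1) (z : V) :
    pz K ν z = ∑' w, om K ν w * (if z ∈ w then 1 else 0) := by
  unfold pz hitProb
  rw [ENNReal.tsum_toReal_eq]
  · refine tsum_congr fun w => ?_
    unfold om; split <;> simp
  · intro w
    split
    · have h1 : walkProb K ν w ≤ ∑' w, walkProb K ν w := ENNReal.le_tsum w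
      rw [hw] at h1
      exact ne_top_of_le_ne_top ENNReal.one_ne_top h1
    · simp

lemma tau_zero : tau K ν 0 = ind := rfl
lemma tau_succ (t : ℕ) (S : Finset V) : tau K ν (t+1) S = Rop K ν (tau K ν t) S := by
  unfold tau; rw [Function.iterate_succ_apply']

lemma Rop_univ (W : WalkLaw K ν) (f : Finset V → ℝ) : Rop K ν f Finset.univ = f Finset.univ := by
  unfold Rop
  simp only [idla_univ]
  rw [tsum_mul_right, W.has.tsum_eq, one_mul]

lemma Rop_erase (W : WalkLaw K ν) (hw : ∑' w, walkProb K ν w = 1) (f : Finset V → ℝ)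
    (hf : f Finset.univ = 0) (z : V) :
    Rop K ν f (Finset.univ.erase z) = (1 - pz K ν z) * f (Finset.univ.erase z) := by
  have hs : Summable fun w => om K ν w * (if z ∈ w then (1:ℝ) else 0) :=
    om_summable W _ 1 (fun w => by split <;> simp)
  have : ∀ w, om K ν w * f (idlaUpdate (Finset.univ.erase z) w)
      = (om K ν w - om K ν w * (if z ∈ w then 1 else 0)) * f (Finset.univ.erase z) := by
    intro w
    rw [idla_erase]
    split <;> simp [hf]
  unfold Rop
  simp only [this]
  rw [tsum_mul_right, W.has.summable.tsum_sub hs, W.has.tsum_eq, ← pz_eq W hw]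

lemma tau_univ (W : WalkLaw K ν) (t : ℕ) : tau K ν t Finset.univ = 0 := by
  induction t with
  | zero => simp [tau_zero, ind]
  | succ t ih => rw [tau_succ, Rop_univ W, ih]

lemma tau_erase (W : WalkLaw K ν) (hw : ∑' w, walkProb K ν w = 1) (t : ℕ) (z : V) :
    tau K ν t (Finset.univ.erase z) = (1 - pz K ν z) ^ t := by
  induction t with
  | zero =>
    have : Finset.univ.erase z ≠ Finset.univ := fun h => by
      have := Finset.mem_univ z; rw [← h] at this; simp at this
    simp [tau_zero, ind, this]
  | succ t ih => rw [tau_succ, Rop_erase W hw _ (tau_univ W t), ih]; ring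

lemma tau_nonneg (W : WalkLaw K ν) (t : ℕ) (S : Finset V) : 0 ≤ tau K ν t S := by
  induction t generalizing S with
  | zero => rw [tau_zero, ind]; split <;> norm_num
  | succ t ih =>
    rw [tau_succ, ← Rop_const W 0 S]
    exact Rop_mono W ih S

lemma Rop_insert (W : WalkLaw K ν) {f : Finset V → ℝ} (h : ∀ S z, f (insert z S) ≤ f S)
    (S : Finset V) (z : V) : Rop K ν f (insert z S) ≤ Rop K ν f S := by
  have := Rop_le W f f (insert z S) S 0 (fun w => by
    rcases idla_insert S z w with e | ⟨z', e⟩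
    · rw [e]; simp
    · rw [e]; simpa using h _ _)
  simpa using this

lemma Rop_insert' (W : WalkLaw K ν) {f : Finset V → ℝ} {C : ℝ} (hC : 0 ≤ C)
    (h : ∀ S z, f S ≤ f (insert z S) + C)
    (S : Finset V) (z : V) : Rop K ν f S ≤ Rop K ν f (insert z S) + C := by
  refine Rop_le W f f S (insert z S) C (fun w => ?_)
  rcases idla_insert S z w with e | ⟨z', e⟩
  · rw [e]; linarith
  · rw [e]; exact h _ _

lemma ind_insert (S : Finset V) (z : V) : ind (insert z S) ≤ ind S := by
  unfold ind
  by_cases h : S = Finset.univ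
  · simp [h]
  · simp only [h, if_false]; split <;> norm_num

lemma tau_insert (W : WalkLaw K ν) (t : ℕ) (S : Finset V) (z : V) :
    tau K ν t (insert z S) ≤ tau K ν t S := by
  induction t generalizing S z with
  | zero => exact ind_insert S z
  | succ t ih => rw [tau_succ, tau_succ]; exact Rop_insert W ih S z

lemma tau_le_empty (W : WalkLaw K ν) (t : ℕ) (S : Finset V) : tau K ν t S ≤ tau K ν t ∅ := by
  induction S using Finset.induction_on with
  | empty => exact le_rfl
  | insert x S _ ih => exact (tau_insert W t S x).trans ih

lemma tau_anti (W : WalkLaw K ν) (t : ℕ) (S : Finset V) : tau K ν (t+1) S ≤ tau K ν t S := by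
  rw [tau_succ]
  conv_rhs => rw [← Rop_const W (tau K ν t S) S]
  have := Rop_le W (tau K ν t) (fun _ => tau K ν t S) S S 0 (fun w => by
    rcases idla_one S w with e | ⟨z, e⟩
    · rw [e]; simp
    · rw [e]; simpa using tau_insert W t S z)
  simpa using this

lemma tau_antitone (W : WalkLaw K ν) (S : Finset V) : Antitone fun t => tau K ν t S :=
  antitone_nat_of_succ_le fun t => tau_anti W t S

lemma tau_le_one (W : WalkLaw K ν) (t : ℕ) (S : Finset V) : tau K ν t S ≤ 1 := by
  refine (tau_antitone W S (Nat.zero_le t)).trans ?_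
  simp only [tau_zero, ind]; split <;> norm_num

lemma pz_le_one (W : WalkLaw K ν) (hw : ∑' w, walkProb K ν w = 1) (z : V) : pz K ν z ≤ 1 := by
  have h := tau_nonneg W 1 (Finset.univ.erase z)
  rw [tau_erase W hw] at h; linarith [h, pow_one (1 - pz K ν z)]

noncomputable def fs (K : V → V → ℝ≥0∞) (ν : V → ℝ≥0∞) (t : ℕ) (S : Finset V) : ℝ :=
  ∑ s ∈ Finset.range t, tau K ν s S

lemma fs_succ (W : WalkLaw K ν) (t : ℕ) (S : Finset V) :
    fs K ν (t+1) S = ind S + Rop K ν (fs K ν t) S := by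
  induction t generalizing S with
  | zero =>
    have : fs K ν 0 = fun _ => 0 := by funext S; simp [fs]
    rw [this, Rop_const W]; simp [fs, tau_zero]
  | succ t ih =>
    have e : fs K ν (t+1) = fun S => fs K ν t S + tau K ν t S := by
      funext S; simp [fs, Finset.sum_range_succ]
    have e2 : fs K ν (t+1+1) S = fs K ν (t+1) S + tau K ν (t+1) S := by
      simp [fs, Finset.sum_range_succ]
    rw [e2, ih, e, Rop_add W, tau_succ]; ring

lemma fs_univ (W : WalkLaw K ν) (t : ℕ) : fs K ν t Finset.univ = 0 := by
  simp [fs, tau_univ W]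

lemma fs_insert (W : WalkLaw K ν) (t : ℕ) (S : Finset V) (z : V) :
    fs K ν t (insert z S) ≤ fs K ν t S :=
  Finset.sum_le_sum fun s _ => tau_insert W s S z

lemma fs_erase (W : WalkLaw K ν) (hw : ∑' w, walkProb K ν w = 1) {C : ℝ}
    (hp : ∀ z, 0 < pz K ν z) (hC : ∀ z, 1 ≤ C * pz K ν z) (t : ℕ) (z : V) :
    fs K ν t (Finset.univ.erase z) ≤ C := by
  simp only [fs, tau_erase W hw]
  have h1 := geom_sum_mul (1 - pz K ν z) t
  have h2 : 0 ≤ (1 - pz K ν z) ^ t := pow_nonneg (by linarith [pz_le_one W hw z]) t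
  have h3 : (∑ i ∈ Finset.range t, (1 - pz K ν z) ^ i) * pz K ν z ≤ C * pz K ν z := by
    have := hC z; nlinarith
  exact le_of_mul_le_mul_right h3 (hp z)

lemma fs_insert' (W : WalkLaw K ν) (hw : ∑' w, walkProb K ν w = 1) {C : ℝ} (hC0 : 0 ≤ C)
    (hp : ∀ z, 0 < pz K ν z) (hC : ∀ z, 1 ≤ C * pz K ν z) (t : ℕ) (S : Finset V) (z : V) :
    fs K ν t S ≤ fs K ν t (insert z S) + C := by
  induction t generalizing S z with
  | zero => simp [fs, hC0]
  | succ t ih =>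
    by_cases hz : z ∈ S
    · rw [Finset.insert_eq_of_mem hz]; linarith
    by_cases h : insert z S = Finset.univ
    · have : S = Finset.univ.erase z := by rw [← h, Finset.erase_insert hz]
      rw [h, fs_univ W, this]
      simpa using fs_erase W hw hp hC _ _
    · have h' : S ≠ Finset.univ := fun e => hz (by rw [e]; exact Finset.mem_univ z)
      rw [fs_succ W, fs_succ W]
      have := Rop_insert' W hC0 ih S z
      simp only [ind, h, h', if_false]; linarith

lemma fs_le (W : WalkLaw K ν) (hw : ∑' w, walkProb K ν w = 1) {C : ℝ} (hC0 : 0 ≤ C)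
    (hp : ∀ z, 0 < pz K ν z) (hC : ∀ z, 1 ≤ C * pz K ν z) (t : ℕ) (S : Finset V) :
    fs K ν t S ≤ C * Fintype.card V := by
  have key : ∀ T : Finset V, fs K ν t Tᶜ ≤ C * T.card := by
    intro T
    induction T using Finset.induction_on with
    | empty => simp [fs_univ W]
    | insert x T hx ih =>
      have h1 := fs_insert' W hw hC0 hp hC t (insert x T)ᶜ x
      have h2 : insert x (insert x T)ᶜ = Tᶜ := by
        ext y; simp only [Finset.mem_insert, Finset.mem_compl]
        by_cases h : y = x
        · subst h; simp [hx]
        · simp [h]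
      rw [h2] at h1
      rw [Finset.card_insert_of_notMem hx]; push_cast; linarith
  have h1 := key Sᶜ
  rw [compl_compl] at h1
  have h2 : ((Sᶜ).card : ℝ) ≤ Fintype.card V := by exact_mod_cast Finset.card_le_univ _
  exact h1.trans (mul_le_mul_of_nonneg_left h2 hC0)

noncomputable def ff (K : V → V → ℝ≥0∞) (ν : V → ℝ≥0∞) (S : Finset V) : ℝ := ∑' t, tau K ν t S

section
variable (W : WalkLaw K ν) (hw : ∑' w, walkProb K ν w = 1) {C : ℝ} (hC0 : 0 ≤ C)
    (hp : ∀ z, 0 < pz K ν z) (hC : ∀ z, 1 ≤ C * pz K ν z)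

lemma tau_summable (W : WalkLaw K ν) (hw : ∑' w, walkProb K ν w = 1) {C : ℝ} (hC0 : 0 ≤ C)
    (hp : ∀ z, 0 < pz K ν z) (hC : ∀ z, 1 ≤ C * pz K ν z) (S : Finset V) :
    Summable fun t => tau K ν t S :=
  summable_of_sum_range_le (fun t => tau_nonneg W t S) (fun t => fs_le W hw hC0 hp hC t S)

lemma fs_tendsto (W : WalkLaw K ν) (hw : ∑' w, walkProb K ν w = 1) {C : ℝ} (hC0 : 0 ≤ C)
    (hp : ∀ z, 0 < pz K ν z) (hC : ∀ z, 1 ≤ C * pz K ν z) (S : Finset V) :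
    Tendsto (fun t => fs K ν t S) atTop (nhds (ff K ν S)) :=
  (tau_summable W hw hC0 hp hC S).hasSum.tendsto_sum_nat

lemma ff_rec (W : WalkLaw K ν) (hw : ∑' w, walkProb K ν w = 1) {C : ℝ} (hC0 : 0 ≤ C)
    (hp : ∀ z, 0 < pz K ν z) (hC : ∀ z, 1 ≤ C * pz K ν z) (S : Finset V) :
    ff K ν S = ind S + Rop K ν (ff K ν) S := by
  have h1 := (fs_tendsto W hw hC0 hp hC S).comp (tendsto_add_atTop_nat 1)
  have h2 : Tendsto (fun t => Rop K ν (fs K ν t) S) atTop (nhds (Rop K ν (ff K ν) S)) := by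
    refine tendsto_tsum_of_dominated_convergence
      (bound := fun w => om K ν w * (C * Fintype.card V)) (W.has.summable.mul_right _) ?_ ?_
    · intro w
      exact (fs_tendsto W hw hC0 hp hC _).const_mul _
    · refine Eventually.of_forall fun t w => ?_
      rw [Real.norm_eq_abs, abs_mul, abs_of_nonneg (om_nonneg ν w)]
      refine mul_le_mul_of_nonneg_left ?_ (om_nonneg ν w)
      have h0 : 0 ≤ fs K ν t (idlaUpdate S w) := Finset.sum_nonneg fun s _ => tau_nonneg W s _
      rw [abs_of_nonneg h0]
      exact fs_le W hw hC0 hp hC t _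
  refine tendsto_nhds_unique h1 ?_
  simp only [Function.comp_def, fs_succ W]
  exact h2.const_add _

lemma ff_insert (W : WalkLaw K ν) (hw : ∑' w, walkProb K ν w = 1) {C : ℝ} (hC0 : 0 ≤ C)
    (hp : ∀ z, 0 < pz K ν z) (hC : ∀ z, 1 ≤ C * pz K ν z) (S : Finset V) (z : V) :
    ff K ν (insert z S) ≤ ff K ν S :=
  le_of_tendsto_of_tendsto' (fs_tendsto W hw hC0 hp hC _) (fs_tendsto W hw hC0 hp hC _)
    fun t => fs_insert W t S z

lemma ff_insert' (W : WalkLaw K ν) (hw : ∑' w, walkProb K ν w = 1) {C : ℝ} (hC0 : 0 ≤ C)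
    (hp : ∀ z, 0 < pz K ν z) (hC : ∀ z, 1 ≤ C * pz K ν z) (S : Finset V) (z : V) :
    ff K ν S ≤ ff K ν (insert z S) + C :=
  le_of_tendsto_of_tendsto' (fs_tendsto W hw hC0 hp hC _)
    ((fs_tendsto W hw hC0 hp hC _).add_const C)
    fun t => fs_insert' W hw hC0 hp hC t S z

lemma ff_nonneg (W : WalkLaw K ν) (S : Finset V) : 0 ≤ ff K ν S :=
  tsum_nonneg fun t => tau_nonneg W t S

lemma ff_sq (W : WalkLaw K ν) (hw : ∑' w, walkProb K ν w = 1) {C : ℝ} (hC0 : 0 ≤ C)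
    (hp : ∀ z, 0 < pz K ν z) (hC : ∀ z, 1 ≤ C * pz K ν z) (S : Finset V) (hS : S ≠ Finset.univ) :
    Rop K ν (fun S => ff K ν S ^ 2) S ≤ ff K ν S ^ 2 - 2 * ff K ν S + C := by
  have hr := ff_rec W hw hC0 hp hC S
  simp only [ind, hS, if_false] at hr
  have h := Rop_le W (fun S => ff K ν S ^ 2) (fun T => (2 * ff K ν S - C) * ff K ν T) S S
    (C * ff K ν S - ff K ν S ^ 2) (fun w => by
      have hD : 0 ≤ ff K ν S - ff K ν (idlaUpdate S w) ∧
          ff K ν S - ff K ν (idlaUpdate S w) ≤ C := by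
        rcases idla_one S w with e | ⟨z, e⟩
        · rw [e]; constructor <;> linarith
        · rw [e]
          have h1 := ff_insert W hw hC0 hp hC S z
          have h2 := ff_insert' W hw hC0 hp hC S z
          constructor <;> linarith
      nlinarith [mul_nonneg hD.1 (sub_nonneg.2 hD.2)])
  rw [Rop_smul] at h
  have h3 : Rop K ν (ff K ν) S = ff K ν S - 1 := by linarith
  rw [h3] at h
  nlinarith

noncomputable def ms (K : V → V → ℝ≥0∞) (ν : V → ℝ≥0∞) (t : ℕ) (S : Finset V) : ℝ :=
  ∑ s ∈ Finset.range t, (2 * (s:ℝ) + 1) * tau K ν s S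

lemma ms_succ (W : WalkLaw K ν) (t : ℕ) (S : Finset V) :
    ms K ν (t+1) S = ind S + Rop K ν (ms K ν t) S + 2 * Rop K ν (fs K ν t) S := by
  induction t generalizing S with
  | zero =>
    have h0 : fs K ν 0 = fun _ => 0 := by funext S; simp [fs]
    have h1 : ms K ν 0 = fun _ => 0 := by funext S; simp [ms]
    rw [h0, h1, Rop_const W]; simp [ms, tau_zero]
  | succ t ih =>
    have e : fs K ν (t+1) = fun S => fs K ν t S + tau K ν t S := by
      funext S; simp [fs, Finset.sum_range_succ]
    have e1 : ms K ν (t+1) = fun S => ms K ν t S + (2 * (t:ℝ) + 1) * tau K ν t S := by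
      funext S; simp [ms, Finset.sum_range_succ]
    have e2 : ms K ν (t+1+1) S = ms K ν (t+1) S + (2 * ((t:ℝ)+1) + 1) * tau K ν (t+1) S := by
      simp [ms, Finset.sum_range_succ]
    rw [e2, ih, e, e1, Rop_add W, Rop_add W, Rop_smul, tau_succ]; ring

lemma ms_le (W : WalkLaw K ν) (hw : ∑' w, walkProb K ν w = 1) {C : ℝ} (hC1 : 1 ≤ C)
    (hp : ∀ z, 0 < pz K ν z) (hC : ∀ z, 1 ≤ C * pz K ν z) (t : ℕ) (S : Finset V) :
    ms K ν t S ≤ ff K ν S ^ 2 + (C - 1) * ff K ν S := by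
  have hC0 : 0 ≤ C := by linarith
  induction t generalizing S with
  | zero =>
    simp only [ms, Finset.range_zero, Finset.sum_empty]
    have := ff_nonneg W S
    have h2 : 0 ≤ C - 1 := by linarith
    positivity
  | succ t ih =>
    by_cases hS : S = Finset.univ
    · subst hS
      have : ff K ν Finset.univ = 0 := by simp [ff, tau_univ W]
      rw [this]; simp [ms, tau_univ W]
    · rw [ms_succ W]
      have h1 := Rop_mono W ih S
      rw [Rop_add W (fun S => ff K ν S ^ 2), Rop_smul] at h1
      have h2 : Rop K ν (fs K ν t) S ≤ Rop K ν (ff K ν) S := Rop_mono W (fun T =>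
        (tau_summable W hw hC0 hp hC T).sum_le_tsum _ (fun i _ => tau_nonneg W i T)) S
      have h3 := ff_sq W hw hC0 hp hC S hS
      have hr := ff_rec W hw hC0 hp hC S
      simp only [ind, hS, if_false] at hr ⊢
      have h4 : Rop K ν (ff K ν) S = ff K ν S - 1 := by linarith
      rw [h4] at h1 h2
      nlinarith
end
end P5
end ARW

set_option linter.unusedSectionVars false
set_option linter.unusedVariables false

namespace ARW
section P6

structure Facts (C E : ℝ) (dtv dsep : ℕ → ℝ) : Prop where
  hC : 1 ≤ C
  sum : HasSum dsep E
  anti : Antitone dsep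
  nonneg : ∀ t, 0 ≤ dsep t
  le_one : ∀ t, dsep t ≤ 1
  sec : ∀ N, ∑ s ∈ Finset.range N, (2 * (s:ℝ) + 1) * dsep s ≤ E ^ 2 + (C - 1) * E
  low : ∀ t, (1 - 1 / C) ^ t ≤ 2 * dtv t
  tv : ∀ t, dtv t ≤ dsep t

lemma tv_le {S : Type} [Fintype S] [DecidableEq S] [Nonempty S] (M : Matrix S S ℝ) (π : S → ℝ) (t : ℕ)
    (c : ℝ) (hM : ∀ b, ∑ ξ, M b ξ = 1) (hπ : IsStationary M π) (hMt : ∀ b, ∑ ξ, (M ^ t) b ξ = 1)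
    (hc : 0 ≤ c) (h : ∀ b ξ, (1 - c) * π ξ ≤ (M ^ t) b ξ) : tvDist M π t ≤ c := by
  refine ciSup_le fun b => ciSup_le fun A => ?_
  have key : ∀ A : Finset S, -c ≤ ∑ ξ ∈ A, ((M ^ t) b ξ - π ξ) := by
    intro A
    have h1 : ∑ ξ ∈ A, (-c) * π ξ ≤ ∑ ξ ∈ A, ((M ^ t) b ξ - π ξ) :=
      Finset.sum_le_sum fun ξ _ => by have := h b ξ; linarith
    rw [← Finset.mul_sum] at h1
    have h2 : ∑ ξ ∈ A, π ξ ≤ 1 := by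
      rw [← hπ.2.1]
      exact Finset.sum_le_sum_of_subset_of_nonneg (Finset.subset_univ _) fun i _ _ => hπ.1 i
    nlinarith
  have h3 := Finset.sum_add_sum_compl A fun ξ => (M ^ t) b ξ - π ξ
  rw [Finset.sum_sub_distrib (s := Finset.univ), hMt, hπ.2.1] at h3
  rw [abs_le]
  exact ⟨key A, by have := key Aᶜ; linarith⟩

lemma tv_ge {S : Type} [Fintype S] [DecidableEq S] (M : Matrix S S ℝ) (π : S → ℝ) (t : ℕ)
    (b : S) (A : Finset S) : |∑ ξ ∈ A, ((M ^ t) b ξ - π ξ)| ≤ tvDist M π t := by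
  unfold tvDist
  exact le_trans (le_ciSup (f := fun A : Finset S => |∑ ξ ∈ A, ((M ^ t) b ξ - π ξ)|)
    (Set.finite_range _).bddAbove A)
    (le_ciSup (f := fun b => ⨆ A : Finset S, |∑ ξ ∈ A, ((M ^ t) b ξ - π ξ)|)
    (Set.finite_range _).bddAbove b)

lemma tv_l1 {S : Type} [Fintype S] [DecidableEq S] (M : Matrix S S ℝ) (π : S → ℝ) (t : ℕ)
    (b : S) : ∑ ξ, |(M ^ t) b ξ - π ξ| ≤ 2 * tvDist M π t := by
  classical
  rw [← Finset.sum_filter_add_sum_filter_not Finset.univ (fun ξ => 0 ≤ (M ^ t) b ξ - π ξ)]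
  have h1 := (le_abs_self _).trans (tv_ge M π t b (Finset.univ.filter fun ξ => 0 ≤ (M ^ t) b ξ - π ξ))
  have h2 := (neg_le_abs _).trans (tv_ge M π t b (Finset.univ.filter fun ξ => ¬ 0 ≤ (M ^ t) b ξ - π ξ))
  rw [← Finset.sum_neg_distrib] at h2
  have e1 : ∑ ξ ∈ Finset.univ.filter (fun ξ => 0 ≤ (M ^ t) b ξ - π ξ), |(M ^ t) b ξ - π ξ|
      = ∑ ξ ∈ Finset.univ.filter (fun ξ => 0 ≤ (M ^ t) b ξ - π ξ), ((M ^ t) b ξ - π ξ) :=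
    Finset.sum_congr rfl fun ξ hξ => abs_of_nonneg (Finset.mem_filter.1 hξ).2
  have e2 : ∑ ξ ∈ Finset.univ.filter (fun ξ => ¬ 0 ≤ (M ^ t) b ξ - π ξ), |(M ^ t) b ξ - π ξ|
      = ∑ ξ ∈ Finset.univ.filter (fun ξ => ¬ 0 ≤ (M ^ t) b ξ - π ξ), -((M ^ t) b ξ - π ξ) :=
    Finset.sum_congr rfl fun ξ hξ => abs_of_neg (not_le.1 (Finset.mem_filter.1 hξ).2)
  rw [e1, e2]; linarith

lemma stat_pow {S : Type} [Fintype S] [DecidableEq S] {M : Matrix S S ℝ} {π : S → ℝ}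
    (hπ : IsStationary M π) (t : ℕ) (ξ : S) : ∑ r, π r * (M ^ t) r ξ = π ξ := by
  induction t generalizing ξ with
  | zero => simp [Matrix.one_apply]
  | succ t ih =>
    simp only [pow_succ, Matrix.mul_apply, Finset.mul_sum]
    rw [Finset.sum_comm]
    simp only [← mul_assoc, ← Finset.sum_mul, ih]
    exact hπ.2.2 ξ

lemma tv_entry {S : Type} [Fintype S] [DecidableEq S] {M : Matrix S S ℝ} {π : S → ℝ}
    (hπ : IsStationary M π) (hMt : ∀ t b, ∑ ξ, (M ^ t) b ξ = 1) (t k : ℕ) (b ξ : S) :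
    |(M ^ (t * k)) b ξ - π ξ| ≤ (2 * tvDist M π t) ^ k := by
  induction k generalizing b with
  | zero =>
    rw [mul_zero, pow_zero, pow_zero, Matrix.one_apply]
    have h1 := hπ.1 ξ
    have h2 : π ξ ≤ 1 := by
      rw [← hπ.2.1]; exact Finset.single_le_sum (fun i _ => hπ.1 i) (Finset.mem_univ ξ)
    rw [abs_le]; split <;> constructor <;> linarith
  | succ k ih =>
    have e : (M ^ (t * (k+1))) b ξ - π ξ
        = ∑ c, ((M ^ t) b c - π c) * ((M ^ (t * k)) c ξ - π ξ) := by
      have e1 : (M ^ (t * (k+1))) b ξ = ∑ c, (M ^ t) b c * (M ^ (t * k)) c ξ := by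
        rw [mul_add, mul_one, add_comm, pow_add, Matrix.mul_apply]
      simp only [sub_mul, mul_sub, Finset.sum_sub_distrib, ← Finset.sum_mul]
      rw [← e1, hMt, hπ.2.1, stat_pow hπ]; ring
    rw [e]
    calc |∑ c, ((M ^ t) b c - π c) * ((M ^ (t * k)) c ξ - π ξ)|
        ≤ ∑ c, |((M ^ t) b c - π c) * ((M ^ (t * k)) c ξ - π ξ)| := Finset.abs_sum_le_sum_abs _ _
      _ ≤ ∑ c, |(M ^ t) b c - π c| * (2 * tvDist M π t) ^ k := by
          refine Finset.sum_le_sum fun c _ => ?_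
          rw [abs_mul]
          exact mul_le_mul_of_nonneg_left (ih c) (abs_nonneg _)
      _ ≤ (2 * tvDist M π t) ^ (k+1) := by
          rw [← Finset.sum_mul, pow_succ']
          exact mul_le_mul_of_nonneg_right (tv_l1 M π t b) ((abs_nonneg _).trans (ih b))

lemma pow_compare {a b c : ℝ} (hc : 0 < c) (hb : 0 ≤ b) (h : ∀ k : ℕ, c * a ^ k ≤ b ^ k) : a ≤ b := by
  by_contra hab
  push Not at hab
  have ha : 0 < a := lt_of_le_of_lt hb hab
  have h1 : Tendsto (fun k : ℕ => (b / a) ^ k) atTop (nhds 0) :=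
    tendsto_pow_atTop_nhds_zero_of_lt_one (div_nonneg hb ha.le) ((div_lt_one ha).2 hab)
  have h2 : c ≤ 0 := ge_of_tendsto' h1 fun k => by
    rw [div_pow, le_div_iff₀ (pow_pos ha k)]; exact h k
  linarith

variable {V : Type} [Fintype V] [DecidableEq V] {K : V → V → ℝ≥0∞} {ν : V → ℝ≥0∞}

lemma facts [Nonempty V] (hsub : SubStochastic K) (hnd : NonDegenerate K) (hν : IsProbVec ν)
    (hadm : Admissible K ν) {lam : ℝ} (hlam : 0 < lam) {π : (V → Bool) → ℝ}
    (hπ : IsStationary (arwMatrix K lam ν) π) :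
    ∃ C E, Facts C E (tvDist (arwMatrix K lam ν) π) (sepDist (arwMatrix K lam ν) π) := by
  have W := walkLaw hsub hnd hν
  have hw := walk_total hsub hnd hν
  have hp : ∀ z, 0 < pz K ν z := fun z => by
    refine ENNReal.toReal_pos (hadm z).ne' ?_
    refine ne_top_of_le_ne_top ENNReal.one_ne_top ?_
    rw [← hw]
    refine ENNReal.tsum_le_tsum fun w => ?_
    split
    · exact le_rfl
    · exact zero_le
  obtain ⟨z, -, hz⟩ := Finset.exists_min_image Finset.univ (pz K ν) Finset.univ_nonempty
  have hC1 : 1 ≤ 1 / pz K ν z := by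
    rw [le_div_iff₀ (hp z), one_mul]; exact pz_le_one W hw z
  have hC0 : 0 ≤ 1 / pz K ν z := by linarith
  have hC : ∀ y, 1 ≤ (1 / pz K ν z) * pz K ν y := fun y => by
    rw [one_div, inv_mul_eq_div, le_div_iff₀ (hp z), one_mul]; exact hz y (Finset.mem_univ y)
  have hsum := tau_summable W hw hC0 hp hC ∅
  have hlim := hsum.tendsto_atTop_zero
  have hmu := mu_pos hsub hnd hlam
  have hge : ∀ ξ, mu K lam ξ ≤ π ξ := by
    intro ξ
    have h1 : ∀ t, (1 - tau K ν t ∅) * mu K lam ξ ≤ π ξ := by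
      intro t
      calc (1 - tau K ν t ∅) * mu K lam ξ = ∑ r, π r * ((1 - tau K ν t ∅) * mu K lam ξ) := by
            rw [← Finset.sum_mul, hπ.2.1, one_mul]
        _ ≤ ∑ r, π r * (arwMatrix K lam ν ^ t) r ξ := Finset.sum_le_sum fun r _ =>
            mul_le_mul_of_nonneg_left (Pt_ge hsub hnd lam hν ξ r t) (hπ.1 r)
        _ = π ξ := stat_pow hπ t ξ
    have h2 : Tendsto (fun t => (1 - tau K ν t ∅) * mu K lam ξ) atTop (nhds ((1 - 0) * mu K lam ξ)) :=
      (hlim.const_sub 1).mul_const _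
    have := le_of_tendsto' h2 h1
    linarith
  have hpi : ∀ ξ, mu K lam ξ = π ξ := by
    intro ξ
    have := (Finset.sum_eq_sum_iff_of_le (s := Finset.univ) (fun ξ _ => hge ξ)).1
      (by rw [hπ.2.1, mu_sum hsub hnd])
    exact this ξ (Finset.mem_univ ξ)
  have hpos : ∀ ξ, 0 < π ξ := fun ξ => by rw [← hpi]; exact hmu ξ
  have hge' : ∀ t b ξ, (1 - tau K ν t ∅) * π ξ ≤ (arwMatrix K lam ν ^ t) b ξ := fun t b ξ => by
    rw [← hpi]; exact Pt_ge hsub hnd lam hν ξ b t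
  have hsep : ∀ t, sepDist (arwMatrix K lam ν) π t = tau K ν t ∅ := by
    intro t
    unfold sepDist
    apply le_antisymm
    · refine ciSup_le fun b => ciSup_le fun ξ => ?_
      have := hge' t b ξ
      rw [← le_div_iff₀ (hpos ξ)] at this; linarith
    · refine le_trans ?_ (le_ciSup (Set.finite_range _).bddAbove (fun _ => false))
      refine le_trans ?_ (le_ciSup (Set.finite_range _).bddAbove (fun _ => true))
      rw [Pt_full hsub hnd lam hν, hpi, mul_div_assoc, div_self (hpos _).ne']; linarith
  have hlow : ∀ t, (1 - pz K ν z) ^ t ≤ tau K ν t ∅ := fun t => by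
    rw [← tau_erase W hw]; exact tau_le_empty W t _
  have htv0 : ∀ t, 0 ≤ tvDist (arwMatrix K lam ν) π t := fun t =>
    (abs_nonneg _).trans (tv_ge _ π t (fun _ => false) ∅)
  have hfun : sepDist (arwMatrix K lam ν) π = fun t => tau K ν t ∅ := funext hsep
  refine ⟨1 / pz K ν z, ff K ν ∅, ⟨hC1, ?_, ?_, ?_, ?_, ?_, ?_, ?_⟩⟩
  · rw [hfun]; exact hsum.hasSum
  · rw [hfun]; exact tau_antitone W ∅
  · rw [hfun]; exact fun t => tau_nonneg W t ∅
  · rw [hfun]; exact fun t => tau_le_one W t ∅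
  · rw [hfun]; exact fun N => ms_le W hw hC1 hp hC N ∅
  · intro t
    rw [one_div_one_div]
    refine pow_compare (hpos fun _ => true) (by linarith [htv0 t]) fun k => ?_
    have h1 := tv_entry hπ (Pt_sum hsub hnd lam hν) t k (fun _ => false) (fun _ => true)
    rw [Pt_full hsub hnd lam hν, hpi] at h1
    have h2 := (neg_le_abs _).trans h1
    have h3 := mul_le_mul_of_nonneg_left (hlow (t * k)) (hpos fun _ => true).le
    rw [← pow_mul]; linarith
  · intro t
    rw [hfun]
    exact tv_le _ π t _ (P_sum hsub hnd lam hν) hπ (Pt_sum hsub hnd lam hν t) (tau_nonneg W t ∅) (hge' t)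

/-! Chebyshev -/

lemma cheb_id (p : ℕ → ℝ) (E : ℝ) (N : ℕ) :
    E ^ 2 + ∑ s ∈ Finset.range N, (2 * (s:ℝ) + 1 - 2 * E) * p s
      = (1 - p 0) * E ^ 2 + ∑ k ∈ Finset.range N, (p k - p (k+1)) * ((k:ℝ) + 1 - E) ^ 2
        + p N * ((N:ℝ) - E) ^ 2 := by
  induction N with
  | zero => simp; ring
  | succ N ih =>
    rw [Finset.sum_range_succ, Finset.sum_range_succ, ← add_assoc, ih]
    push_cast; ring

variable {C E : ℝ} {dtv p : ℕ → ℝ}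

lemma Facts.E_nonneg (F : Facts C E dtv p) : 0 ≤ E := F.sum.nonneg F.nonneg

lemma Facts.tend (F : Facts C E dtv p) : Tendsto p atTop (nhds 0) := F.sum.summable.tendsto_atTop_zero

/-- the total second moment bound -/
lemma Facts.mom (F : Facts C E dtv p) (N : ℕ) :
    (1 - p 0) * E ^ 2 + ∑ k ∈ Finset.range N, (p k - p (k+1)) * ((k:ℝ) + 1 - E) ^ 2
      ≤ (C - 1) * E + 2 * E * (E - ∑ s ∈ Finset.range N, p s) := by
  have h := cheb_id p E N
  have h2 := F.sec N
  have h3 : ∑ s ∈ Finset.range N, (2 * (s:ℝ) + 1 - 2 * E) * p s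
      = ∑ s ∈ Finset.range N, (2 * (s:ℝ) + 1) * p s - 2 * E * ∑ s ∈ Finset.range N, p s := by
    rw [Finset.mul_sum, ← Finset.sum_sub_distrib]
    exact Finset.sum_congr rfl fun s _ => by ring
  have h4 : 0 ≤ p N * ((N:ℝ) - E) ^ 2 := mul_nonneg (F.nonneg N) (sq_nonneg _)
  rw [h3] at h
  nlinarith

lemma Facts.rem_tend (F : Facts C E dtv p) :
    Tendsto (fun N => (C - 1) * E + 2 * E * (E - ∑ s ∈ Finset.range N, p s)) atTop
      (nhds ((C - 1) * E)) := by
  have := ((F.sum.tendsto_sum_nat.const_sub E).const_mul (2 * E)).const_add ((C-1) * E)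
  simpa using this

lemma Facts.cheb_lo (F : Facts C E dtv p) (t : ℕ) (ht : (t:ℝ) ≤ E) :
    (1 - p t) * ((t:ℝ) - E) ^ 2 ≤ (C - 1) * E := by
  refine ge_of_tendsto F.rem_tend ?_
  filter_upwards [eventually_ge_atTop t] with N hN
  refine le_trans ?_ (F.mom N)
  have h1 : ∑ k ∈ Finset.range t, (p k - p (k+1)) * ((t:ℝ) - E) ^ 2
      ≤ ∑ k ∈ Finset.range N, (p k - p (k+1)) * ((k:ℝ) + 1 - E) ^ 2 := by
    refine le_trans (Finset.sum_le_sum fun k hk => ?_) (Finset.sum_le_sum_of_subset_of_nonneg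
      (Finset.range_subset_range.2 hN) fun k _ _ => ?_)
    · refine mul_le_mul_of_nonneg_left ?_ (sub_nonneg.2 (F.anti (Nat.le_succ k)))
      have : (k:ℝ) + 1 ≤ t := by exact_mod_cast Finset.mem_range.1 hk
      nlinarith
    · exact mul_nonneg (sub_nonneg.2 (F.anti (Nat.le_succ k))) (sq_nonneg _)
  rw [← Finset.sum_mul, Finset.sum_range_sub'] at h1
  have h2 : (1 - p 0) * ((t:ℝ) - E) ^ 2 ≤ (1 - p 0) * E ^ 2 := by
    refine mul_le_mul_of_nonneg_left ?_ (by linarith [F.le_one 0])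
    have : (0:ℝ) ≤ t := Nat.cast_nonneg t
    nlinarith
  nlinarith

lemma Facts.cheb_hi (F : Facts C E dtv p) (t : ℕ) (ht : E ≤ (t:ℝ) + 1) :
    p t * ((t:ℝ) + 1 - E) ^ 2 ≤ (C - 1) * E := by
  have h0 : Tendsto (fun N => (C - 1) * E + 2 * E * (E - ∑ s ∈ Finset.range N, p s)
      + p N * ((t:ℝ) + 1 - E) ^ 2) atTop (nhds ((C - 1) * E)) := by
    have := F.rem_tend.add (F.tend.mul_const (((t:ℝ) + 1 - E) ^ 2))
    simpa using this
  refine ge_of_tendsto h0 ?_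
  filter_upwards [eventually_ge_atTop t] with N hN
  have h3 := F.mom N
  have h1 : ∑ k ∈ Finset.Ico t N, (p k - p (k+1)) * ((t:ℝ) + 1 - E) ^ 2
      ≤ ∑ k ∈ Finset.range N, (p k - p (k+1)) * ((k:ℝ) + 1 - E) ^ 2 := by
    refine le_trans (Finset.sum_le_sum fun k hk => ?_) (Finset.sum_le_sum_of_subset_of_nonneg
      (s := Finset.Ico t N) (fun k hk => Finset.mem_range.2 (Finset.mem_Ico.1 hk).2) fun k _ _ => ?_)
    · refine mul_le_mul_of_nonneg_left ?_ (sub_nonneg.2 (F.anti (Nat.le_succ k)))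
      have : (t:ℝ) ≤ k := by exact_mod_cast (Finset.mem_Ico.1 hk).1
      nlinarith
    · exact mul_nonneg (sub_nonneg.2 (F.anti (Nat.le_succ k))) (sq_nonneg _)
  have h4 : ∑ k ∈ Finset.Ico t N, (p k - p (k+1)) = p t - p N := by
    have := Finset.sum_Ico_sub (fun k => - p k) hN
    rw [show p t - p N = -p N - -p t by ring, ← this]
    exact Finset.sum_congr rfl fun k _ => by ring
  rw [← Finset.sum_mul, h4] at h1
  have h2 : 0 ≤ (1 - p 0) * E ^ 2 := mul_nonneg (by linarith [F.le_one 0]) (sq_nonneg _)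
  nlinarith

end P6
end ARW

set_option linter.unusedSectionVars false
set_option linter.unusedVariables false

namespace ARW
section P7
variable {C E : ℝ} {dtv p : ℕ → ℝ}

lemma Facts.lo (F : Facts C E dtv p) {δ ε : ℝ} (hε : 0 < ε) (hE : 1 / 2 ≤ E)
    (h : C - 1 ≤ δ * E) (t : ℕ) (ht : (t:ℝ) ≤ (1 - ε) * E) : (1 - p t) * ε ^ 2 ≤ δ := by
  have hE0 : 0 < E := by linarith
  have h1 := F.cheb_lo t (by nlinarith)
  have h2 : (ε * E) ^ 2 ≤ ((t:ℝ) - E) ^ 2 := by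
    have : 0 ≤ ε * E := by positivity
    nlinarith
  have h3 : (1 - p t) * (ε * E) ^ 2 ≤ δ * E * E :=
    (mul_le_mul_of_nonneg_left h2 (by linarith [F.le_one t])).trans
      (h1.trans (mul_le_mul_of_nonneg_right h hE0.le))
  have h4 : ((1 - p t) * ε ^ 2) * (E * E) ≤ δ * (E * E) := by nlinarith
  exact le_of_mul_le_mul_right h4 (by positivity)

lemma Facts.hi (F : Facts C E dtv p) {δ ε : ℝ} (hε : 0 < ε) (hE : 1 / 2 ≤ E)
    (h : C - 1 ≤ δ * E) (t : ℕ) (ht : (1 + ε) * E ≤ (t:ℝ) + 1) : p t * ε ^ 2 ≤ δ := by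
  have hE0 : 0 < E := by linarith
  have h1 := F.cheb_hi t (by nlinarith)
  have h2 : (ε * E) ^ 2 ≤ ((t:ℝ) + 1 - E) ^ 2 := by
    have : 0 ≤ ε * E := by positivity
    nlinarith
  have h3 : p t * (ε * E) ^ 2 ≤ δ * E * E :=
    (mul_le_mul_of_nonneg_left h2 (F.nonneg t)).trans
      (h1.trans (mul_le_mul_of_nonneg_right h hE0.le))
  have h4 : (p t * ε ^ 2) * (E * E) ≤ δ * (E * E) := by nlinarith
  exact le_of_mul_le_mul_right h4 (by positivity)

lemma Facts.ts (F : Facts C E dtv p) {δ ε : ℝ} (hε : 0 < ε) (hE : 1 / 2 ≤ E)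
    (h : C - 1 ≤ δ * E) (hδ : δ < ε ^ 2 / 2) :
    ((sInf {t : ℕ | p t ≤ 1 / 2} : ℕ) : ℝ) ≤ (1 + ε) * E ∧
      (1 - ε) * E ≤ ((sInf {t : ℕ | p t ≤ 1 / 2} : ℕ) : ℝ) := by
  have hne : {t : ℕ | p t ≤ 1 / 2}.Nonempty := by
    have := F.tend.eventually (ge_mem_nhds (show (0:ℝ) < 1 / 2 by norm_num))
    exact this.exists
  have hE0 : 0 < E := by linarith
  set s := sInf {t : ℕ | p t ≤ 1 / 2} with hs
  have hε2 : 0 < ε ^ 2 := by positivity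
  constructor
  · by_contra hc
    push Not at hc
    have hs0 : s ≠ 0 := by
      intro h0; rw [h0] at hc; push_cast at hc
      have : 0 < (1 + ε) * E := by positivity
      linarith
    obtain ⟨t, ht⟩ := Nat.exists_eq_succ_of_ne_zero hs0
    have h1 : t ∉ {t : ℕ | p t ≤ 1 / 2} := Nat.notMem_of_lt_sInf (by rw [← hs, ht]; exact Nat.lt_succ_self t)
    simp only [Set.mem_setOf_eq, not_le] at h1
    have h2 := F.hi hε hE h t (by rw [ht] at hc; push_cast at hc; linarith)
    nlinarith
  · by_contra hc
    push Not at hc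
    have h1 : p s ≤ 1 / 2 := Nat.sInf_mem hne
    have h2 := F.lo hε hE h s hc.le
    nlinarith

lemma Facts.mean (F : Facts C E dtv p) (m : ℕ) (h : ∀ t < m, 1 / 2 < dtv t) : (m:ℝ) / 2 ≤ E := by
  refine le_trans ?_ (sum_le_hasSum (Finset.range m) (fun t _ => F.nonneg t) F.sum)
  calc (m:ℝ) / 2 = ∑ t ∈ Finset.range m, (1 / 2 : ℝ) := by simp; ring
    _ ≤ _ := Finset.sum_le_sum fun t ht =>
      (h t (Finset.mem_range.1 ht)).le.trans (F.tv t)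

lemma Facts.kap (F : Facts C E dtv p) {δ : ℝ} (hδ : 0 < δ) (m : ℕ) (hm : 1 ≤ m)
    (h : 2 * dtv (2 * m) < Real.exp (-(2 / δ))) : C - 1 ≤ δ * m := by
  by_contra hc
  push Not at hc
  have hm' : (1:ℝ) ≤ m := by exact_mod_cast hm
  have hr : 0 < C - 1 := lt_of_le_of_lt (by positivity) hc
  have hC : 0 < C := by linarith
  have h1 : Real.exp (-(1 / (C - 1))) ≤ 1 - 1 / C := by
    have h2 : C / (C - 1) ≤ Real.exp (1 / (C - 1)) := by
      have := Real.add_one_le_exp (1 / (C - 1))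
      have e : C / (C - 1) = 1 / (C - 1) + 1 := by field_simp; ring
      rw [e]; exact this
    rw [Real.exp_neg]
    have e : 1 - 1 / C = (C / (C - 1))⁻¹ := by field_simp
    rw [e]
    exact inv_anti₀ (by positivity) h2
  have h2 : Real.exp (-(2 / δ)) ≤ (1 - 1 / C) ^ (2 * m) := by
    refine le_trans ?_ (pow_le_pow_left₀ (Real.exp_pos _).le h1 (2 * m))
    rw [← Real.exp_nat_mul, Real.exp_le_exp]
    push_cast
    have : 2 * (m:ℝ) * (1 / (C - 1)) ≤ 2 / δ := by
      rw [mul_one_div, div_le_div_iff₀ hr hδ]; nlinarith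
    linarith
  linarith [F.low (2 * m)]

lemma cutoff_main {C E : ℕ → ℝ} {dtv p : ℕ → ℕ → ℝ} (F : ∀ n, Facts (C n) (E n) (dtv n) (p n))
    (htv : HasCutoff dtv (fun n => sInf {t : ℕ | dtv n t ≤ 1 / 2})) :
    HasCutoff p (fun n => sInf {t : ℕ | p n t ≤ 1 / 2}) := by
  have key : ∀ δ : ℝ, 0 < δ → ∀ᶠ n in atTop, 1 / 2 ≤ E n ∧ C n - 1 ≤ δ * E n := by
    intro δ hδ
    have h0 := (htv 0 le_rfl).1 one_pos
    have h2 := (htv 2 (by norm_num)).2 (by norm_num)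
    have h3 := (h2.const_mul 2)
    rw [mul_zero] at h3
    filter_upwards [h0.eventually (lt_mem_nhds (show (1/2:ℝ) < 1 by norm_num)),
      h3.eventually (gt_mem_nhds (Real.exp_pos (-(2 / (δ / 2)))))] with n hn0 hn2
    set m := sInf {t : ℕ | dtv n t ≤ 1 / 2} with hm
    have hne : {t : ℕ | dtv n t ≤ 1 / 2}.Nonempty := by
      have := (F n).tend.eventually (ge_mem_nhds (show (0:ℝ) < 1 / 2 by norm_num))
      obtain ⟨t, ht⟩ := this.exists
      exact ⟨t, ((F n).tv t).trans ht⟩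
    have hm1 : 1 ≤ m := by
      by_contra hc
      have h0 : m = 0 := by omega
      have h1 : dtv n m ≤ 1 / 2 := Nat.sInf_mem hne
      rw [h0] at h1
      simp at hn0 h1
      linarith
    have e : ⌊(2:ℝ) * (m:ℝ)⌋₊ = 2 * m := by
      rw [show (2:ℝ) * (m:ℝ) = ((2 * m : ℕ) : ℝ) by push_cast; ring, Nat.floor_natCast]
    rw [e] at hn2
    have h4 := (F n).kap (half_pos hδ) m hm1 hn2
    have h5 := (F n).mean m fun t ht => by
      have := Nat.notMem_of_lt_sInf (s := {t : ℕ | dtv n t ≤ 1 / 2}) ht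
      simpa using this
    have hm' : (1:ℝ) ≤ m := by exact_mod_cast hm1
    constructor
    · linarith
    · nlinarith
  intro α hα
  constructor
  · intro h1
    set ε := (1 - α) / 2 with hε
    have hε0 : 0 < ε := by rw [hε]; linarith
    rw [Metric.tendsto_nhds]
    intro η hη
    have hε2 : 0 < ε ^ 2 := by positivity
    have hδ : 0 < min (ε ^ 2 / 4) (ε ^ 2 * η / 2) := lt_min (by positivity) (by positivity)
    filter_upwards [key _ hδ] with n ⟨hE, hC⟩
    obtain ⟨ha, hb⟩ := (F n).ts hε0 hE hC (lt_of_le_of_lt (min_le_left _ _) (by linarith))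
    set s := sInf {t : ℕ | p n t ≤ 1 / 2}
    have h3 := (F n).lo hε0 hE hC ⌊α * (s:ℝ)⌋₊ (by
      have h4 : (⌊α * (s:ℝ)⌋₊ : ℝ) ≤ α * s := Nat.floor_le (by positivity)
      have h5 : α * (s:ℝ) ≤ α * ((1 + ε) * E n) := mul_le_mul_of_nonneg_left ha hα
      have h6 : α * (1 + ε) ≤ 1 - ε := by rw [hε]; nlinarith
      have h7 : α * (1 + ε) * E n ≤ (1 - ε) * E n := mul_le_mul_of_nonneg_right h6 (by linarith)
      linarith)
    have h4 := h3.trans (min_le_right _ _)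
    have h5 := (F n).le_one ⌊α * (s:ℝ)⌋₊
    rw [Real.dist_eq, abs_sub_comm, abs_of_nonneg (by linarith)]
    by_contra hc
    push Not at hc
    nlinarith
  · intro h1
    set ε := (α - 1) / (α + 1) with hε
    have hε0 : 0 < ε := div_pos (by linarith) (by linarith)
    rw [Metric.tendsto_nhds]
    intro η hη
    have hε2 : 0 < ε ^ 2 := by positivity
    have hδ : 0 < min (ε ^ 2 / 4) (ε ^ 2 * η / 2) := lt_min (by positivity) (by positivity)
    filter_upwards [key _ hδ] with n ⟨hE, hC⟩
    obtain ⟨ha, hb⟩ := (F n).ts hε0 hE hC (lt_of_le_of_lt (min_le_left _ _) (by linarith))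
    set s := sInf {t : ℕ | p n t ≤ 1 / 2}
    have h3 := (F n).hi hε0 hE hC ⌊α * (s:ℝ)⌋₊ (by
      have h4 : α * s < (⌊α * (s:ℝ)⌋₊ : ℝ) + 1 := Nat.lt_floor_add_one _
      have h5 : α * ((1 - ε) * E n) ≤ α * (s:ℝ) := mul_le_mul_of_nonneg_left hb hα
      have h6 : α * (1 - ε) = 1 + ε := by rw [hε]; field_simp; ring
      rw [← mul_assoc, h6] at h5
      linarith)
    have h4 := h3.trans (min_le_right _ _)
    have h5 := (F n).nonneg ⌊α * (s:ℝ)⌋₊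
    rw [Real.dist_eq, sub_zero, abs_of_nonneg h5]
    by_contra hc
    push Not at hc
    nlinarith

end P7
end ARW

namespace ARW

/-- **Corollary (Total-variation cutoff implies separation cutoff)** for sequences of
ARW chains. -/
theorem arw_tv_cutoff_implies_sep_cutoff
    {V : ℕ → Type} [∀ n, Fintype (V n)] [∀ n, DecidableEq (V n)] [∀ n, Nonempty (V n)]
    (K : ∀ n, V n → V n → ℝ≥0∞) (hsub : ∀ n, SubStochastic (K n))
    (hnd : ∀ n, NonDegenerate (K n))
    (ν : ∀ n, V n → ℝ≥0∞) (hν : ∀ n, IsProbVec (ν n)) (hadm : ∀ n, Admissible (K n) (ν n))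
    (lam : ℕ → ℝ) (hlam : ∀ n, 0 < lam n)
    (π : ∀ n, (V n → Bool) → ℝ)
    (hπ : ∀ n, IsStationary (arwMatrix (K n) (lam n) (ν n)) (π n))
    (htv : HasCutoff (fun n t => tvDist (arwMatrix (K n) (lam n) (ν n)) (π n) t)
        (fun n => tvMix (arwMatrix (K n) (lam n) (ν n)) (π n) (1 / 2))) :
    HasCutoff (fun n t => sepDist (arwMatrix (K n) (lam n) (ν n)) (π n) t)
        (fun n => sepMix (arwMatrix (K n) (lam n) (ν n)) (π n) (1 / 2)) := by
  have h := fun n => facts (hsub n) (hnd n) (hν n) (hadm n) (hlam n) (hπ n)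
  choose C E F using h
  exact cutoff_main F htv

end ARW
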